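/- arXiv:2211.14888 — 2 statements merged into one kernel-verified Lean document; each statement's English description precedes it below -/
import Mathlib

section
/- Every characteristic value λ of the eigenvalue problem (EVP) is real; moreover every positive characteristic value satisfies λ ≤ √(g/L₀). -/
/-!
STATEMENT 0: Every characteristic value λ of the eigenvalue problem (EVP) is real;
moreover every positive characteristic value satisfies λ ≤ √(g/L₀).
-/

open MeasureTheory Real Set Filter

noncomputable section

/-- The eigenvalue problem (EVP): the fourth order ODE
`λ²(k²ρ₀φ − (ρ₀φ')') + λμ(φ'''' − 2k²φ'' + k⁴φ) = gk²ρ₀'φ` on `ℝ₋ = (-∞,0)`,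
the two boundary conditions at `x₃ = 0`, and decay at `-∞`, for a (complex)
characteristic value `lam` and a solution `φ ∈ H⁴(ℝ₋)` (encoded as `C⁴` regularity
together with square-integrability on `(-∞,0)` of all derivatives of order `≤ 4`). -/
def IsEVPSolutionC (μ g k ρp : ℝ) (ρ₀ : ℝ → ℝ) (lam : ℂ) (φ : ℝ → ℂ) : Prop :=
  ContDiff ℝ 4 φ ∧
  (∀ n ≤ 4, Integrable (fun x => ‖iteratedDeriv n φ x‖ ^ 2)
      (volume.restrict (Iio (0 : ℝ)))) ∧
  (∀ x < (0 : ℝ),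
    lam ^ 2 * (((k ^ 2 * ρ₀ x : ℝ) : ℂ) * φ x
        - deriv (fun y => ((ρ₀ y : ℝ) : ℂ) * deriv φ y) x)
      + lam * (μ : ℂ) * (iteratedDeriv 4 φ x - 2 * (k : ℂ) ^ 2 * iteratedDeriv 2 φ x
          + (k : ℂ) ^ 4 * φ x)
      = ((g * k ^ 2 * deriv ρ₀ x : ℝ) : ℂ) * φ x) ∧
  ((μ : ℂ) * ((k : ℂ) ^ 2 * φ 0 + iteratedDeriv 2 φ 0) = 0) ∧
  (-(lam * (μ : ℂ)) * iteratedDeriv 3 φ 0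
      + (3 * lam * (μ : ℂ) * (k : ℂ) ^ 2 + lam ^ 2 * (ρp : ℂ)) * deriv φ 0
      + ((g * k ^ 2 * ρp : ℝ) : ℂ) * φ 0 = 0) ∧
  Tendsto φ atBot (nhds 0)

/-- A bounded continuous weight times a product of two continuous square-integrable functions
is integrable. -/
theorem integrableOn_weight_mul_conj {s : Set ℝ} (hs : MeasurableSet s) {w : ℝ → ℝ} {u v : ℝ → ℂ}
    {C : ℝ} (hw : Continuous w) (hwC : ∀ x ∈ s, |w x| ≤ C) (hu : Continuous u) (hv : Continuous v)
    (hu2 : IntegrableOn (fun x => ‖u x‖ ^ 2) s) (hv2 : IntegrableOn (fun x => ‖v x‖ ^ 2) s) :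
    IntegrableOn (fun x => (w x : ℂ) * (u x * starRingEnd ℂ (v x))) s := by
  refine Integrable.mono' ((hu2.add hv2).const_mul C) ?_ ?_
  · exact ((Complex.continuous_ofReal.comp hw).mul
      (hu.mul (Complex.continuous_conj.comp hv))).aestronglyMeasurable
  · filter_upwards [ae_restrict_mem hs] with x hx
    have h1 := hwC x hx
    have h2 : ‖u x‖ * ‖v x‖ ≤ ‖u x‖ ^ 2 + ‖v x‖ ^ 2 := by
      nlinarith [sq_nonneg (‖u x‖ - ‖v x‖), sq_nonneg ‖u x‖, sq_nonneg ‖v x‖]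
    simp only [norm_mul, Complex.norm_real, Real.norm_eq_abs, RCLike.norm_conj, Pi.add_apply]
    exact mul_le_mul h1 h2 (by positivity) ((abs_nonneg _).trans h1)

/-- A bounded continuous weight times the squared norm of a square-integrable function
is integrable. -/
theorem integrableOn_weight_mul_norm_sq {s : Set ℝ} (hs : MeasurableSet s) {w : ℝ → ℝ} {u : ℝ → ℂ}
    {C : ℝ} (hw : Continuous w) (hwC : ∀ x ∈ s, |w x| ≤ C)
    (hu2 : IntegrableOn (fun x => ‖u x‖ ^ 2) s) :
    IntegrableOn (fun x => w x * ‖u x‖ ^ 2) s :=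
  Integrable.bdd_mul (c := C) hu2 hw.aestronglyMeasurable
    (by filter_upwards [ae_restrict_mem hs] with x hx using hwC x hx)

/-- The iterated derivative of order `n < 4` of a `C⁴` function is differentiable. -/
theorem ContDiff.hasDerivAt_iteratedDeriv_of_lt {φ : ℝ → ℂ} (hφ : ContDiff ℝ 4 φ) {n : ℕ}
    (hn : n < 4) (x : ℝ) : HasDerivAt (iteratedDeriv n φ) (iteratedDeriv (n + 1) φ x) x := by
  rw [iteratedDeriv_succ]
  exact (hφ.differentiable_iteratedDeriv n (by exact_mod_cast hn) x).hasDerivAt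

/-- The energy flux of the eigenvalue problem. -/
def evpFlux (μ k : ℝ) (ρ₀ : ℝ → ℝ) (lam : ℂ) (φ : ℝ → ℂ) (x : ℝ) : ℂ :=
  -lam ^ 2 * ((ρ₀ x : ℂ) * (iteratedDeriv 1 φ x * starRingEnd ℂ (φ x)))
    + lam * μ * (iteratedDeriv 3 φ x * starRingEnd ℂ (φ x)
      - iteratedDeriv 2 φ x * starRingEnd ℂ (iteratedDeriv 1 φ x)
      - 3 * (k : ℂ) ^ 2 * (iteratedDeriv 1 φ x * starRingEnd ℂ (φ x))
      - (k : ℂ) ^ 2 * (φ x * starRingEnd ℂ (iteratedDeriv 1 φ x)))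

theorem IsEVPSolutionC.hasDerivAt_evpFlux {μ g k ρp : ℝ} {ρ₀ : ℝ → ℝ} {lam : ℂ} {φ : ℝ → ℂ}
    (hφ : IsEVPSolutionC μ g k ρp ρ₀ lam φ) (hρ : Differentiable ℝ ρ₀) {x : ℝ} (hx : x < 0) :
    HasDerivAt (evpFlux μ k ρ₀ lam φ)
      (((g * k ^ 2 * (deriv ρ₀ x * ‖φ x‖ ^ 2) : ℝ) : ℂ)
        - lam ^ 2 * ((k ^ 2 * (ρ₀ x * ‖φ x‖ ^ 2) + ρ₀ x * ‖iteratedDeriv 1 φ x‖ ^ 2 : ℝ) : ℂ)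
        - lam * μ * ((‖iteratedDeriv 2 φ x + (k : ℂ) ^ 2 * φ x‖ ^ 2
          + 4 * k ^ 2 * ‖iteratedDeriv 1 φ x‖ ^ 2 : ℝ) : ℂ)) x := by
  obtain ⟨hC, -, hode, -, -, -⟩ := hφ
  have d0 : HasDerivAt φ (iteratedDeriv 1 φ x) x := by
    simpa using hC.hasDerivAt_iteratedDeriv_of_lt (n := 0) (by norm_num) x
  have d1 := hC.hasDerivAt_iteratedDeriv_of_lt (n := 1) (by norm_num) x
  have d2 := hC.hasDerivAt_iteratedDeriv_of_lt (n := 2) (by norm_num) x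
  have d3 := hC.hasDerivAt_iteratedDeriv_of_lt (n := 3) (by norm_num) x
  have dρ : HasDerivAt (fun y => (ρ₀ y : ℂ)) ((deriv ρ₀ x : ℝ) : ℂ) x :=
    (hρ x).hasDerivAt.ofReal_comp
  have c0 : HasDerivAt (fun y => starRingEnd ℂ (φ y)) (starRingEnd ℂ (iteratedDeriv 1 φ x)) x :=
    d0.star
  have c1 : HasDerivAt (fun y => starRingEnd ℂ (iteratedDeriv 1 φ y))
      (starRingEnd ℂ (iteratedDeriv 2 φ x)) x := d1.star
  have hode := hode x hx
  have e1 : deriv (fun y => ((ρ₀ y : ℝ) : ℂ) * deriv φ y) x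
      = ((deriv ρ₀ x : ℝ) : ℂ) * iteratedDeriv 1 φ x + (ρ₀ x : ℂ) * iteratedDeriv 2 φ x := by
    rw [show deriv φ = iteratedDeriv 1 φ from iteratedDeriv_one.symm]
    exact (dρ.mul d1).deriv
  rw [e1] at hode
  have main := ((dρ.mul (d1.mul c0)).const_mul (-lam ^ 2)).add
    (((((d3.mul c0).sub (d2.mul c1)).sub ((d1.mul c0).const_mul (3 * (k : ℂ) ^ 2))).sub
      ((d0.mul c1).const_mul ((k : ℂ) ^ 2))).const_mul (lam * μ))
  refine main.congr_deriv ?_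
  push_cast at hode ⊢
  simp only [← Complex.mul_conj', Pi.mul_apply, map_add, map_mul, map_pow, Complex.conj_ofReal]
  linear_combination (starRingEnd ℂ (φ x)) * hode

theorem IsEVPSolutionC.evpFlux_zero {μ g k ρp : ℝ} {ρ₀ : ℝ → ℝ} {lam : ℂ} {φ : ℝ → ℂ}
    (hφ : IsEVPSolutionC μ g k ρp ρ₀ lam φ) (hρp : ρ₀ 0 = ρp) :
    evpFlux μ k ρ₀ lam φ 0 = ((g * k ^ 2 * ρp * ‖φ 0‖ ^ 2 : ℝ) : ℂ) := by
  obtain ⟨-, -, -, hb1, hb2, -⟩ := hφ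
  rw [← iteratedDeriv_one] at hb2
  push_cast at hb2 ⊢
  rw [← Complex.mul_conj', evpFlux, hρp]
  linear_combination -(starRingEnd ℂ (φ 0)) * hb2
    - lam * (starRingEnd ℂ (iteratedDeriv 1 φ 0)) * hb1

/-- The energy identity `gk²ρ₊|φ(0)|² = gk² P - λ² A - λμ B`, where `P = ∫ ρ₀'|φ|²`,
`A = ∫ k²ρ₀|φ|² + ρ₀|φ'|²` and `B = ∫ |φ'' + k²φ|² + 4k²|φ'|²`. -/
theorem IsEVPSolutionC.energy_identity {μ g k ρp C C' : ℝ} {ρ₀ : ℝ → ℝ} {lam : ℂ} {φ : ℝ → ℂ}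
    (hφ : IsEVPSolutionC μ g k ρp ρ₀ lam φ) (hρ : ContDiff ℝ 1 ρ₀) (hρp : ρ₀ 0 = ρp)
    (hC : ∀ x ∈ Iio (0 : ℝ), |ρ₀ x| ≤ C) (hC' : ∀ x ∈ Iio (0 : ℝ), |deriv ρ₀ x| ≤ C') :
    ((g * k ^ 2 * ρp * ‖φ 0‖ ^ 2 : ℝ) : ℂ)
      = ((g * k ^ 2 * ∫ x in Iio (0 : ℝ), deriv ρ₀ x * ‖φ x‖ ^ 2 : ℝ) : ℂ)
        - lam ^ 2 * ((k ^ 2 * (∫ x in Iio (0 : ℝ), ρ₀ x * ‖φ x‖ ^ 2)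
          + ∫ x in Iio (0 : ℝ), ρ₀ x * ‖iteratedDeriv 1 φ x‖ ^ 2 : ℝ) : ℂ)
        - lam * μ * ((∫ x in Iio (0 : ℝ), (‖iteratedDeriv 2 φ x + (k : ℂ) ^ 2 * φ x‖ ^ 2
          + 4 * k ^ 2 * ‖iteratedDeriv 1 φ x‖ ^ 2) : ℝ) : ℂ) := by
  have hφ' := hφ
  obtain ⟨hcd, hint, -⟩ := hφ'
  have cont : ∀ n ≤ 4, Continuous (iteratedDeriv n φ) := fun n hn =>
    hcd.continuous_iteratedDeriv n (by exact_mod_cast hn)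
  have ms : MeasurableSet (Iio (0 : ℝ)) := measurableSet_Iio
  have k0 : Continuous φ := hcd.continuous
  have k1 := cont 1 (by norm_num)
  have k2 := cont 2 (by norm_num)
  have k3 := cont 3 (by norm_num)
  have i0 : IntegrableOn (fun x => ‖φ x‖ ^ 2) (Iio 0) := by
    simpa [IntegrableOn] using hint 0 (by norm_num)
  have i1 : IntegrableOn (fun x => ‖iteratedDeriv 1 φ x‖ ^ 2) (Iio 0) := hint 1 (by norm_num)
  have i2 : IntegrableOn (fun x => ‖iteratedDeriv 2 φ x‖ ^ 2) (Iio 0) := hint 2 (by norm_num)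
  have i3 : IntegrableOn (fun x => ‖iteratedDeriv 3 φ x‖ ^ 2) (Iio 0) := hint 3 (by norm_num)
  have prod : ∀ {u v : ℝ → ℂ}, Continuous u → Continuous v →
      IntegrableOn (fun x => ‖u x‖ ^ 2) (Iio 0) → IntegrableOn (fun x => ‖v x‖ ^ 2) (Iio 0) →
      IntegrableOn (fun x => u x * starRingEnd ℂ (v x)) (Iio 0) := fun hu hv hu2 hv2 => by
    simpa using integrableOn_weight_mul_conj (w := fun _ => 1) (C := 1) ms continuous_const
      (by simp) hu hv hu2 hv2
  have hF : IntegrableOn (evpFlux μ k ρ₀ lam φ) (Iic 0) := by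
    rw [integrableOn_Iic_iff_integrableOn_Iio]
    exact ((integrableOn_weight_mul_conj ms hρ.continuous hC k1 k0 i1 i0).const_mul _).add
      (((((prod k3 k0 i3 i0).sub (prod k2 k1 i2 i1)).sub ((prod k1 k0 i1 i0).const_mul _)).sub
        ((prod k0 k1 i0 i1).const_mul _)).const_mul _)
  have jP := integrableOn_weight_mul_norm_sq ms (hρ.continuous_deriv le_rfl) hC' i0
  have jA0 := integrableOn_weight_mul_norm_sq ms hρ.continuous hC i0
  have jA1 := integrableOn_weight_mul_norm_sq ms hρ.continuous hC i1
  have jA : IntegrableOn (fun x => k ^ 2 * (ρ₀ x * ‖φ x‖ ^ 2)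
      + ρ₀ x * ‖iteratedDeriv 1 φ x‖ ^ 2) (Iio 0) := (jA0.const_mul (k ^ 2)).add jA1
  have jB : IntegrableOn (fun x => ‖iteratedDeriv 2 φ x + (k : ℂ) ^ 2 * φ x‖ ^ 2
      + 4 * k ^ 2 * ‖iteratedDeriv 1 φ x‖ ^ 2) (Iio 0) := by
    refine Integrable.add ?_ (i1.const_mul _)
    have hkc : Continuous fun x => (k : ℂ) ^ 2 * φ x := continuous_const.mul k0
    have m2 : MemLp (iteratedDeriv 2 φ) 2 (volume.restrict (Iio (0 : ℝ))) :=
      (memLp_two_iff_integrable_sq_norm k2.aestronglyMeasurable).2 i2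
    have m0 : MemLp φ 2 (volume.restrict (Iio (0 : ℝ))) :=
      (memLp_two_iff_integrable_sq_norm k0.aestronglyMeasurable).2 i0
    exact (memLp_two_iff_integrable_sq_norm (k2.add hkc).aestronglyMeasurable).1
      (m2.add (m0.const_mul _))
  have jP' : IntegrableOn (fun x => ((g * k ^ 2 * (deriv ρ₀ x * ‖φ x‖ ^ 2) : ℝ) : ℂ)) (Iio 0) :=
    (jP.const_mul (g * k ^ 2)).ofReal
  have jA' : IntegrableOn (fun x => lam ^ 2 * ((k ^ 2 * (ρ₀ x * ‖φ x‖ ^ 2)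
      + ρ₀ x * ‖iteratedDeriv 1 φ x‖ ^ 2 : ℝ) : ℂ)) (Iio 0) := jA.ofReal.const_mul _
  have jB' : IntegrableOn (fun x => lam * μ * ((‖iteratedDeriv 2 φ x + (k : ℂ) ^ 2 * φ x‖ ^ 2
      + 4 * k ^ 2 * ‖iteratedDeriv 1 φ x‖ ^ 2 : ℝ) : ℂ)) (Iio 0) := jB.ofReal.const_mul _
  have jPA : IntegrableOn (fun x => ((g * k ^ 2 * (deriv ρ₀ x * ‖φ x‖ ^ 2) : ℝ) : ℂ)
      - lam ^ 2 * ((k ^ 2 * (ρ₀ x * ‖φ x‖ ^ 2)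
        + ρ₀ x * ‖iteratedDeriv 1 φ x‖ ^ 2 : ℝ) : ℂ)) (Iio 0) := jP'.sub jA'
  have hd := fun x (hx : x ∈ Iio (0 : ℝ)) =>
    hφ.hasDerivAt_evpFlux (hρ.differentiable one_ne_zero) hx
  have hcont : Continuous (evpFlux μ k ρ₀ lam φ) := by
    have := hρ.continuous
    have cc := Complex.continuous_conj
    unfold evpFlux
    fun_prop
  have hlim := tendsto_zero_of_hasDerivAt_of_integrableOn_Iic (a := -1)
    (fun x (hx : x ≤ -1) => hd x (mem_Iio.2 (by linarith)))
    (IntegrableOn.mono_set (jPA.sub jB') fun x (hx : x ≤ -1) => mem_Iio.2 (by linarith))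
    (hF.mono_set (Iic_subset_Iic.2 (by norm_num)))
  have hint := integral_Iic_of_hasDerivAt_of_tendsto hcont.continuousWithinAt hd
    ((integrableOn_Iic_iff_integrableOn_Iio).2 (jPA.sub jB')) hlim
  rw [sub_zero, hφ.evpFlux_zero hρp, integral_Iic_eq_integral_Iio] at hint
  rw [← hint, integral_sub jPA jB', integral_sub jP' jA', integral_const_mul,
    integral_const_mul, integral_complex_ofReal, integral_complex_ofReal, integral_complex_ofReal,
    integral_add (jA0.const_mul _) jA1, integral_const_mul, integral_const_mul]

/-- Every characteristic value `λ` (with `Re λ > 0`, admitting a nontrivial `H⁴(ℝ₋)`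
solution of the EVP) is real, and it satisfies `λ ≤ √(g/L₀)`, where
`L₀⁻¹ = ‖ρ₀'/ρ₀‖_{L^∞(ℝ₋)}`. -/
theorem statement0
    (μ g a k ρm ρp L₀ : ℝ) (ρ₀ : ℝ → ℝ)
    (hμ : 0 < μ) (hg : 0 < g) (ha : 0 < a) (hk : 0 < k) (hρm : 0 < ρm)
    (hρ₀ : ContDiff ℝ (⊤ : ℕ∞) ρ₀) (hρ₀pos : ∀ x ≤ (0 : ℝ), 0 < ρ₀ x)
    (hρ₀mono : ∀ x ≤ (0 : ℝ), 0 ≤ deriv ρ₀ x)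
    (hsupp : tsupport (deriv ρ₀) = Icc (-a) 0)
    (hflat : ∀ x ≤ -a, ρ₀ x = ρm) (hρp : ρ₀ 0 = ρp)
    (hL₀pos : 0 < L₀)
    (hL₀ : L₀⁻¹ = sSup ((fun x => |deriv ρ₀ x| / ρ₀ x) '' Iio (0 : ℝ)))
    (lam : ℂ) (hre : 0 < lam.re)
    (φ : ℝ → ℂ) (hφ : IsEVPSolutionC μ g k ρp ρ₀ lam φ)
    (hnontriv : ∃ x ≤ (0 : ℝ), φ x ≠ 0) :
    lam.im = 0 ∧ lam.re ≤ Real.sqrt (g / L₀) := by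
  have hρ1 : ContDiff ℝ 1 ρ₀ := hρ₀.of_le (by exact_mod_cast le_top)
  have hdiff : Differentiable ℝ ρ₀ := hρ1.differentiable one_ne_zero
  have hmono : MonotoneOn ρ₀ (Iic 0) := by
    refine monotoneOn_of_deriv_nonneg (convex_Iic 0) hdiff.continuous.continuousOn
      hdiff.differentiableOn fun x hx => hρ₀mono x ?_
    rw [interior_Iic] at hx
    exact le_of_lt hx
  have hρle : ∀ x ∈ Iio (0 : ℝ), |ρ₀ x| ≤ ρp := fun x hx => by
    rw [abs_of_pos (hρ₀pos x (le_of_lt hx)), ← hρp]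
    exact hmono (mem_Iic.2 (le_of_lt hx)) (mem_Iic.2 le_rfl) (le_of_lt hx)
  have hbdd : BddAbove ((fun x => |deriv ρ₀ x| / ρ₀ x) '' Iio (0 : ℝ)) := by
    by_contra h
    rw [Real.sSup_of_not_bddAbove h] at hL₀
    exact (inv_pos.2 hL₀pos).ne' hL₀
  have hderiv : ∀ x ∈ Iio (0 : ℝ), |deriv ρ₀ x| ≤ L₀⁻¹ * ρ₀ x := fun x hx => by
    rw [← div_le_iff₀ (hρ₀pos x (le_of_lt hx)), hL₀]
    exact le_csSup hbdd (mem_image_of_mem _ hx)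
  have hderiv' : ∀ x ∈ Iio (0 : ℝ), |deriv ρ₀ x| ≤ L₀⁻¹ * ρp := fun x hx =>
    (hderiv x hx).trans (mul_le_mul_of_nonneg_left ((le_abs_self _).trans (hρle x hx))
      (inv_pos.2 hL₀pos).le)
  have hE := hφ.energy_identity hρ1 hρp hρle hderiv'
  have hφc : Continuous φ := hφ.1.continuous
  have i0 : IntegrableOn (fun x => ‖φ x‖ ^ 2) (Iio 0) := by
    simpa [IntegrableOn] using hφ.2.1 0 (by norm_num)
  have jA0 := integrableOn_weight_mul_norm_sq measurableSet_Iio hdiff.continuous hρle i0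
  have jP := integrableOn_weight_mul_norm_sq measurableSet_Iio (hρ1.continuous_deriv le_rfl)
    hderiv' i0
  have hPle : ∫ x in Iio (0 : ℝ), deriv ρ₀ x * ‖φ x‖ ^ 2
      ≤ L₀⁻¹ * ∫ x in Iio (0 : ℝ), ρ₀ x * ‖φ x‖ ^ 2 := by
    rw [← integral_const_mul]
    refine setIntegral_mono_on jP (jA0.const_mul _) measurableSet_Iio fun x hx => ?_
    rw [← mul_assoc]
    exact mul_le_mul_of_nonneg_right ((le_abs_self _).trans (hderiv x hx)) (by positivity)
  have hA1 : 0 ≤ ∫ x in Iio (0 : ℝ), ρ₀ x * ‖iteratedDeriv 1 φ x‖ ^ 2 :=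
    setIntegral_nonneg measurableSet_Iio fun x hx =>
      mul_nonneg (hρ₀pos x (le_of_lt hx)).le (by positivity)
  have hB : 0 ≤ ∫ x in Iio (0 : ℝ), (‖iteratedDeriv 2 φ x + (k : ℂ) ^ 2 * φ x‖ ^ 2
      + 4 * k ^ 2 * ‖iteratedDeriv 1 φ x‖ ^ 2) :=
    setIntegral_nonneg measurableSet_Iio fun x _ => by positivity
  have hne : ∃ x < (0 : ℝ), φ x ≠ 0 := by
    by_contra! h
    obtain ⟨x, hx, hx0⟩ := hnontriv
    have hclos : EqOn φ (fun _ => 0) (closure (Iio 0)) :=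
      EqOn.closure (fun y hy => h y hy) hφc continuous_const
    rw [closure_Iio] at hclos
    exact hx0 (hclos hx)
  have hA0 : 0 < ∫ x in Iio (0 : ℝ), ρ₀ x * ‖φ x‖ ^ 2 := by
    rw [setIntegral_pos_iff_support_of_nonneg_ae _ jA0]
    · obtain ⟨x, hx, hx0⟩ := hne
      refine IsOpen.measure_pos _ (IsOpen.inter ?_ isOpen_Iio) ⟨x, ?_, hx⟩
      · exact (hdiff.continuous.mul (hφc.norm.pow 2)).isOpen_support
      · exact mul_ne_zero (hρ₀pos x hx.le).ne' (by positivity)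
    · filter_upwards [ae_restrict_mem measurableSet_Iio] with x hx
      exact mul_nonneg (hρ₀pos x (le_of_lt hx)).le (by positivity)
  have hρp0 : 0 < ρp := hρp ▸ hρ₀pos 0 le_rfl
  generalize (∫ x in Iio (0 : ℝ), deriv ρ₀ x * ‖φ x‖ ^ 2) = P at *
  generalize (∫ x in Iio (0 : ℝ), ρ₀ x * ‖φ x‖ ^ 2) = A₀ at *
  generalize (∫ x in Iio (0 : ℝ), ρ₀ x * ‖iteratedDeriv 1 φ x‖ ^ 2) = A₁ at *
  generalize (∫ x in Iio (0 : ℝ), (‖iteratedDeriv 2 φ x + (k : ℂ) ^ 2 * φ x‖ ^ 2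
      + 4 * k ^ 2 * ‖iteratedDeriv 1 φ x‖ ^ 2)) = B at *
  have him := congrArg Complex.im hE
  have hreal := congrArg Complex.re hE
  rw [Complex.sub_im, Complex.sub_im, Complex.im_mul_ofReal, Complex.im_mul_ofReal,
    Complex.im_mul_ofReal, Complex.ofReal_im, Complex.ofReal_im, pow_two lam,
    Complex.mul_im] at him
  rw [Complex.sub_re, Complex.sub_re, Complex.re_mul_ofReal, Complex.re_mul_ofReal,
    Complex.re_mul_ofReal, Complex.ofReal_re, Complex.ofReal_re, pow_two lam,
    Complex.mul_re] at hreal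
  have hA : 0 < k ^ 2 * A₀ + A₁ := by positivity
  have hpos : 0 < 2 * lam.re * (k ^ 2 * A₀ + A₁) + μ * B := by positivity
  have hl : lam.im = 0 := by
    have h : lam.im * (2 * lam.re * (k ^ 2 * A₀ + A₁) + μ * B) = 0 := by linear_combination him
    exact (mul_eq_zero.1 h).resolve_right hpos.ne'
  refine ⟨hl, Real.le_sqrt_of_sq_le ?_⟩
  rw [hl] at hreal
  have h0 : 0 ≤ g * k ^ 2 * ρp * ‖φ 0‖ ^ 2 := by positivity
  have h1 : 0 ≤ lam.re * μ * B := by positivity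
  have h2 : 0 ≤ lam.re ^ 2 * A₁ := by positivity
  have h3 : g * k ^ 2 * P ≤ g * k ^ 2 * (L₀⁻¹ * A₀) :=
    mul_le_mul_of_nonneg_left hPle (by positivity)
  have h4 : lam.re ^ 2 * (k ^ 2 * A₀) ≤ g / L₀ * (k ^ 2 * A₀) := by
    rw [div_eq_mul_inv]
    nlinarith
  exact le_of_mul_le_mul_right h4 (by positivity)
end
end

section
/- There exists an infinite sequence (λₙ, φₙ)_{n≥1} with λₙ ∈ (0, √(g/L₀)) and φₙ ∈ H^∞(ℝ₋) nontrivial such that for each n the pair (λₙ, φₙ) solves the eigenvalue problem (EVP); in particular there are infinitely many characteristic values. -/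
/-!
STATEMENT 1: There exists an infinite sequence (λₙ, φₙ) with λₙ ∈ (0, √(g/L₀)) and
φₙ ∈ H^∞(ℝ₋) nontrivial solving the eigenvalue problem (EVP); in particular there
are infinitely many characteristic values.
-/

open MeasureTheory Real Set Filter

noncomputable section

/-- The eigenvalue problem (EVP) for a real characteristic value `lam` and a
real-valued solution `φ`: the fourth order ODE on `ℝ₋ = (-∞,0)`, the two boundary
conditions at `x₃ = 0`, and decay at `-∞`. -/
def IsEVPSolution (μ g k ρp : ℝ) (ρ₀ : ℝ → ℝ) (lam : ℝ) (φ : ℝ → ℝ) : Prop :=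
  (∀ x < (0 : ℝ),
    lam ^ 2 * (k ^ 2 * ρ₀ x * φ x - deriv (fun y => ρ₀ y * deriv φ y) x)
      + lam * μ * (iteratedDeriv 4 φ x - 2 * k ^ 2 * iteratedDeriv 2 φ x + k ^ 4 * φ x)
      = g * k ^ 2 * deriv ρ₀ x * φ x) ∧
  (μ * (k ^ 2 * φ 0 + iteratedDeriv 2 φ 0) = 0) ∧
  (-(lam * μ) * iteratedDeriv 3 φ 0
      + (3 * lam * μ * k ^ 2 + lam ^ 2 * ρp) * deriv φ 0 + g * k ^ 2 * ρp * φ 0 = 0) ∧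
  Tendsto φ atBot (nhds 0)

/-- Membership in `H^∞(ℝ₋)`: smoothness together with square-integrability on
`(-∞,0)` of all derivatives. -/
def MemHinf (φ : ℝ → ℝ) : Prop :=
  ContDiff ℝ (⊤ : ℕ∞) φ ∧
  ∀ n : ℕ, Integrable (fun x => (iteratedDeriv n φ x) ^ 2) (volume.restrict (Iio (0 : ℝ)))

section Index

variable {H : Type*} [NormedAddCommGroup H] [InnerProductSpace ℝ H]

/-- The quadratic form of `T` is negative definite on some `m`-dimensional subspace. -/
def NegDim (T : H →L[ℝ] H) (m : ℕ) : Prop :=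
  ∃ L : (Fin m → ℝ) →ₗ[ℝ] H, ∀ c ≠ 0, inner ℝ (T (L c)) (L c) < 0

/-- The quadratic form of `T` is coercive on some closed subspace of codimension at most `n`. -/
def PosCodim (T : H →L[ℝ] H) (n : ℕ) : Prop :=
  ∃ ℓ : H →L[ℝ] (Fin n → ℝ), ∃ c > 0, ∀ u, ℓ u = 0 → c * ‖u‖ ^ 2 ≤ inner ℝ (T u) u

/-- The quadratic form of `T` is coercive up to a form of rank at most `n`. -/
def CoerciveModRank (T : H →L[ℝ] H) (n : ℕ) : Prop :=
  ∃ ℓ : H →L[ℝ] (Fin n → ℝ), ∃ c > 0, ∀ u, c * ‖u‖ ^ 2 ≤ inner ℝ (T u) u + ‖ℓ u‖ ^ 2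

lemma CoerciveModRank.posCodim {T : H →L[ℝ] H} {n : ℕ} (h : CoerciveModRank T n) :
    PosCodim T n := by
  obtain ⟨ℓ, c, hc, h⟩ := h
  refine ⟨ℓ, c, hc, fun u hu => ?_⟩
  simpa [hu] using h u

lemma abs_inner_sub_le (T S : H →L[ℝ] H) (u : H) :
    |inner ℝ (T u) u - inner ℝ (S u) u| ≤ ‖T - S‖ * ‖u‖ ^ 2 := by
  rw [← inner_sub_left, ← _root_.sub_apply]
  calc _ ≤ ‖(T - S) u‖ * ‖u‖ := abs_real_inner_le_norm _ _
    _ ≤ ‖T - S‖ * ‖u‖ * ‖u‖ := by gcongr; exact (T - S).le_opNorm u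
    _ = _ := by ring

lemma isOpen_posCodim (n : ℕ) : IsOpen {T : H →L[ℝ] H | PosCodim T n} := by
  rw [Metric.isOpen_iff]
  rintro T ⟨ℓ, c, hc, h⟩
  refine ⟨c / 2, by positivity, fun S hS => ⟨ℓ, c / 2, by positivity, fun u hu => ?_⟩⟩
  rw [Metric.mem_ball, dist_eq_norm] at hS
  have h1 := (abs_le.1 (abs_inner_sub_le S T u)).1
  have h2 := h u hu
  have h3 : ‖S - T‖ * ‖u‖ ^ 2 ≤ c / 2 * ‖u‖ ^ 2 := by gcongr
  linarith

lemma exists_neg_bound {m : ℕ} (T : H →L[ℝ] H) (L : (Fin m → ℝ) →ₗ[ℝ] H)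
    (hL : ∀ c ≠ 0, inner ℝ (T (L c)) (L c) < 0) :
    ∃ δ > 0, ∀ c, inner ℝ (T (L c)) (L c) ≤ -(δ * ‖c‖ ^ 2) := by
  have hLc : Continuous L := L.continuous_of_finiteDimensional
  have hcont : Continuous fun c => inner ℝ (T (L c)) (L c) :=
    (T.continuous.comp hLc).inner hLc
  rcases (Metric.sphere (0 : Fin m → ℝ) 1).eq_empty_or_nonempty with he | hne
  · refine ⟨1, one_pos, fun c => ?_⟩
    by_cases hc : c = 0
    · simp [hc]
    · exfalso
      have : (‖c‖⁻¹ • c) ∈ Metric.sphere (0 : Fin m → ℝ) 1 := by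
        simp [norm_smul, norm_ne_zero_iff.2 hc]
      simp [he] at this
  · obtain ⟨c₀, hc₀, hmax⟩ := (isCompact_sphere (0 : Fin m → ℝ) 1).exists_isMaxOn hne
      hcont.continuousOn
    have hc₀' : c₀ ≠ 0 := by
      rintro rfl
      simp at hc₀
    refine ⟨-inner ℝ (T (L c₀)) (L c₀), by linarith [hL c₀ hc₀'], fun c => ?_⟩
    by_cases hc : c = 0
    · simp [hc]
    · have hmem : (‖c‖⁻¹ • c) ∈ Metric.sphere (0 : Fin m → ℝ) 1 := by
        simp [norm_smul, norm_ne_zero_iff.2 hc]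
      have h1 := hmax hmem
      simp only [mem_ofPred_eq, map_smul, inner_smul_left, inner_smul_right] at h1
      have hn : 0 < ‖c‖ := norm_pos_iff.2 hc
      simp only [conj_trivial] at h1
      rw [← mul_assoc, ← sq, inv_pow, inv_mul_le_iff₀ (by positivity)] at h1
      linarith

lemma isOpen_negDim (m : ℕ) : IsOpen {T : H →L[ℝ] H | NegDim T m} := by
  rw [Metric.isOpen_iff]
  rintro T ⟨L, hL⟩
  obtain ⟨δ, hδ, hb⟩ := exists_neg_bound T L hL
  set K := ‖LinearMap.toContinuousLinearMap L‖ with hK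
  have hLK : ∀ c, ‖L c‖ ≤ K * ‖c‖ := (LinearMap.toContinuousLinearMap L).le_opNorm
  have hK0 : 0 ≤ K := norm_nonneg _
  refine ⟨δ / (K ^ 2 + 1), by positivity, fun S hS => ⟨L, fun c hc => ?_⟩⟩
  rw [Metric.mem_ball, dist_eq_norm, lt_div_iff₀ (by positivity)] at hS
  have hn : 0 < ‖c‖ ^ 2 := by positivity
  have h1 := (abs_le.1 (abs_inner_sub_le S T (L c))).2
  have h2 : ‖S - T‖ * ‖L c‖ ^ 2 ≤ ‖S - T‖ * (K * ‖c‖) ^ 2 := by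
    gcongr; exact hLK c
  have h3 : ‖S - T‖ * K ^ 2 < δ := by nlinarith [norm_nonneg (S - T)]
  nlinarith [hb c]

lemma PosCodim.not_negDim {T : H →L[ℝ] H} {m n : ℕ} (hnm : n < m) (h : PosCodim T n) :
    ¬ NegDim T m := by
  rintro ⟨L, hL⟩
  obtain ⟨ℓ, c, hc, h⟩ := h
  obtain ⟨x, hx, hx0⟩ := Submodule.exists_mem_ne_zero_of_ne_bot
    (LinearMap.ker_ne_bot_of_finrank_lt (f := ℓ.toLinearMap ∘ₗ L) (by simpa using hnm))
  have h1 := h (L x) (by simpa using hx)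
  have h2 := hL x hx0
  have : 0 ≤ c * ‖L x‖ ^ 2 := by positivity
  linarith

lemma inner_eq_zero_of_nonneg {T : H →L[ℝ] H} (hT : T.IsSymmetric) {W : Submodule ℝ H}
    (hW : ∀ w ∈ W, 0 ≤ inner ℝ (T w) w) {w v : H} (hw : w ∈ W) (hv : v ∈ W)
    (h0 : inner ℝ (T w) w = 0) : inner ℝ (T w) v = 0 := by
  have key : ∀ t : ℝ, 0 ≤ 2 * t * inner ℝ (T w) v + t ^ 2 * inner ℝ (T v) v := by
    intro t
    have := hW (w + t • v) (W.add_mem hw (W.smul_mem t hv))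
    have hs : inner ℝ (T v) w = inner ℝ (T w) v := by
      rw [real_inner_comm]; exact (hT w v).symm
    simp only [map_add, map_smul, inner_add_left, inner_add_right, inner_smul_left,
      inner_smul_right, conj_trivial, h0, hs] at this
    linarith
  by_contra hne
  set b := inner ℝ (T w) v
  set q := inner ℝ (T v) v
  have hq : 0 ≤ q := hW v hv
  have h1 := key (-b / (q + 1))
  have h2 : 2 * (-b / (q + 1)) * b + (-b / (q + 1)) ^ 2 * q = -(b ^ 2 * (q + 2)) / (q + 1) ^ 2 := by
    field_simp; ring
  rw [h2] at h1
  have : 0 < b ^ 2 * (q + 2) / (q + 1) ^ 2 := by positivity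
  rw [neg_div] at h1
  linarith

/-- On a closed subspace where an essentially coercive form is nonnegative with trivial radical,
it is coercive. -/
lemma coercive_of_nonneg [CompleteSpace H] {T : H →L[ℝ] H} (hT : T.IsSymmetric) {n : ℕ}
    (hG : CoerciveModRank T n) {W : Submodule ℝ H} (hWc : IsClosed (W : Set H))
    (hW : ∀ w ∈ W, 0 ≤ inner ℝ (T w) w)
    (hrad : ∀ w ∈ W, (∀ v ∈ W, inner ℝ (T w) v = 0) → w = 0) :
    ∃ c > 0, ∀ w ∈ W, c * ‖w‖ ^ 2 ≤ inner ℝ (T w) w := by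
  by_contra! hcon
  obtain ⟨ℓ, c, hc, hG⟩ := hG
  have hunit : ∀ j : ℕ, ∃ w ∈ W, ‖w‖ = 1 ∧ inner ℝ (T w) w < 1 / ((j : ℝ) + 1) := by
    intro j
    obtain ⟨w, hw, hlt⟩ := hcon (1 / ((j : ℝ) + 1)) (by positivity)
    have hw0 : w ≠ 0 := by rintro rfl; simp at hlt
    have hn : 0 < ‖w‖ := norm_pos_iff.2 hw0
    refine ⟨‖w‖⁻¹ • w, W.smul_mem _ hw, by simp [norm_smul, hn.ne'], ?_⟩
    simp only [map_smul, inner_smul_left, inner_smul_right, conj_trivial]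
    rw [← mul_assoc, ← sq, inv_pow, inv_mul_lt_iff₀ (by positivity)]
    linarith
  choose w hwW hw1 hwlt using hunit
  have hb : ∀ j, ℓ (w j) ∈ Metric.closedBall (0 : Fin n → ℝ) ‖ℓ‖ := by
    intro j
    simpa [hw1 j] using ℓ.le_opNorm (w j)
  obtain ⟨y, -, s, hs, hy⟩ := (isCompact_closedBall (0 : Fin n → ℝ) ‖ℓ‖).tendsto_subseq hb
  have hF : Tendsto (fun j => inner ℝ (T (w j)) (w j)) atTop (nhds 0) :=
    squeeze_zero (fun j => hW _ (hwW j)) (fun j => (hwlt j).le) tendsto_one_div_add_atTop_nhds_zero_nat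
  have hcau : CauchySeq (w ∘ s) := by
    rw [Metric.cauchySeq_iff]
    intro ε hε
    obtain ⟨N₁, hN₁⟩ := (Metric.cauchySeq_iff.1 hy.cauchySeq) (√(c * ε ^ 2 / 4)) (by positivity)
    obtain ⟨N₂, hN₂⟩ := eventually_atTop.1
      ((hF.comp hs.tendsto_atTop).eventually_lt_const (show (0 : ℝ) < c * ε ^ 2 / 8 by positivity))
    refine ⟨max N₁ N₂, fun i hi j hj => ?_⟩
    have h1 := hN₁ i (le_of_max_le_left hi) j (le_of_max_le_left hj)
    have h2 := hN₂ i (le_of_max_le_right hi)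
    have h3 := hN₂ j (le_of_max_le_right hj)
    simp only [Function.comp_apply] at h1 h2 h3 ⊢
    rw [dist_eq_norm] at h1 ⊢
    rw [← map_sub] at h1
    have h4 := hG (w (s i) - w (s j))
    have h5 := hW _ (W.add_mem (hwW (s i)) (hwW (s j)))
    have h6 : ‖ℓ (w (s i) - w (s j))‖ ^ 2 < c * ε ^ 2 / 4 := by
      rw [Real.lt_sqrt (norm_nonneg _)] at h1
      exact h1
    simp only [map_add, map_sub, inner_add_left, inner_add_right, inner_sub_left,
      inner_sub_right] at h4 h5 h6
    have h7 : c * ‖w (s i) - w (s j)‖ ^ 2 < c * ε ^ 2 := by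
      have : 0 < c * ε ^ 2 := by positivity
      linarith
    exact lt_of_pow_lt_pow_left₀ 2 hε.le (lt_of_mul_lt_mul_left h7 hc.le)
  obtain ⟨u, hu⟩ := cauchySeq_tendsto_of_complete hcau
  have huW : u ∈ W := hWc.mem_of_tendsto hu (Eventually.of_forall fun j => hwW _)
  have hu1 : ‖u‖ = 1 :=
    tendsto_nhds_unique hu.norm (by simp [hw1])
  have hu0 : inner ℝ (T u) u = 0 :=
    tendsto_nhds_unique (((T.continuous.tendsto u).comp hu).inner hu)
      (hF.comp hs.tendsto_atTop)
  have : u = 0 := hrad u huW fun v hv => inner_eq_zero_of_nonneg hT hW huW hv hu0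
  simp [this] at hu1

lemma exists_posCodim [CompleteSpace H] {T : H →L[ℝ] H} (hT : T.IsSymmetric) {d m : ℕ}
    (hG : CoerciveModRank T d) (hinj : ∀ u, T u = 0 → u = 0) (hm : ¬ NegDim T m) :
    ∃ n < m, PosCodim T n := by
  classical
  have hex : ∃ j, ¬ NegDim T j := ⟨m, hm⟩
  have hle : Nat.find hex ≤ m := Nat.find_min' hex hm
  have h0 : NegDim T 0 := ⟨0, fun c hc => (hc (Subsingleton.elim _ _)).elim⟩
  have hpos : Nat.find hex ≠ 0 := fun h => (h ▸ Nat.find_spec hex) h0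
  obtain ⟨n, hn⟩ := Nat.exists_eq_succ_of_ne_zero hpos
  have hneg : NegDim T n := by
    by_contra h
    have := Nat.find_min' hex h
    omega
  have hnot : ¬ NegDim T (n + 1) := by
    have := Nat.find_spec hex
    rwa [hn] at this
  obtain ⟨L, hL⟩ := hneg
  let ℓ : H →L[ℝ] (Fin n → ℝ) :=
    ContinuousLinearMap.pi fun i => innerSL ℝ (T (L (Pi.single i 1)))
  have hsymm : ∀ u v, inner ℝ (T u) v = inner ℝ (T v) u := fun u v =>
    (hT u v).trans (real_inner_comm _ _)
  have hℓ : ∀ u, ℓ u = 0 → ∀ c, inner ℝ (T (L c)) u = 0 := by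
    intro u hu c
    have : (innerₗ H).flip u ∘ₗ T.toLinearMap ∘ₗ L = 0 := by
      refine (Pi.basisFun ℝ (Fin n)).ext fun i => ?_
      simpa [ℓ, real_inner_comm] using congrFun hu i
    simpa [real_inner_comm] using LinearMap.congr_fun this c
  have hW : ∀ w ∈ ℓ.ker, 0 ≤ inner ℝ (T w) w := by
    intro w hw
    by_contra! hlt
    refine hnot ⟨LinearMap.coprod L (LinearMap.toSpanSingleton ℝ H w) ∘ₗ
      (LinearMap.prod (LinearMap.funLeft ℝ ℝ Fin.castSucc) (LinearMap.proj (Fin.last n))),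
      fun c hc => ?_⟩
    have hcross := hℓ w (by simpa using hw)
    simp only [LinearMap.comp_apply, LinearMap.prod_apply, Function.prod_apply, LinearMap.coprod_apply,
      LinearMap.toSpanSingleton_apply, LinearMap.proj_apply, map_add, map_smul, inner_add_left,
      inner_add_right, inner_smul_left, inner_smul_right, conj_trivial, hcross,
      hsymm w, mul_zero, add_zero, zero_add]
    set c' := LinearMap.funLeft ℝ ℝ Fin.castSucc c with hc'
    by_cases h1 : c' = 0
    · have h2 : c (Fin.last n) ≠ 0 := by
        intro h2
        apply hc
        ext i
        refine Fin.lastCases h2 (fun i => ?_) i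
        exact congrFun h1 i
      have : 0 < c (Fin.last n) ^ 2 := by positivity
      simp only [h1, map_zero, inner_zero_left, zero_add]
      nlinarith
    · nlinarith [hL c' h1, sq_nonneg (c (Fin.last n))]
  have hsurj : ∀ u : H, ∃ c, ℓ (u - L c) = 0 := by
    intro u
    have hi : Function.Injective (ℓ.toLinearMap ∘ₗ L) := by
      rw [injective_iff_map_eq_zero]
      intro c hc
      by_contra hne
      exact (hL c hne).ne (hℓ (L c) (by simpa using hc) c)
    obtain ⟨c, hc⟩ := LinearMap.injective_iff_surjective.1 hi (ℓ u)
    refine ⟨c, ?_⟩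
    have : ℓ (L c) = ℓ u := by simpa using hc
    rw [map_sub, this, sub_self]
  obtain ⟨c, hc, hco⟩ := coercive_of_nonneg hT hG (W := ℓ.ker) ℓ.isClosed_ker hW (by
    intro w hw h
    refine hinj w (ext_inner_right ℝ fun u => ?_)
    obtain ⟨c, hc⟩ := hsurj u
    have h1 := h (u - L c) (by simpa using hc)
    have h2 := hℓ w (by simpa using hw) c
    rw [inner_sub_right, hsymm w (L c), h2, sub_zero] at h1
    simpa using h1)
  exact ⟨n, by omega, ℓ, c, hc, fun u hu => hco u (by simpa using hu)⟩

/-- A continuous family of symmetric, essentially coercive forms whose negative index blows up as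
the parameter tends to `0` is degenerate for infinitely many parameters. -/
theorem infinite_setOf_degenerate [CompleteSpace H] {T : ℝ → H →L[ℝ] H} (hTc : Continuous T)
    (hT : ∀ s, (T s).IsSymmetric) (hG : ∀ s > 0, ∃ n, CoerciveModRank (T s) n)
    (h0 : ∀ m, NegDim (T 0) m) :
    {s : ℝ | 0 < s ∧ ∃ u, u ≠ 0 ∧ T s u = 0}.Infinite := by
  intro hfin
  obtain ⟨ε, hε, hεS⟩ : ∃ ε > 0, ∀ s ∈ Ioc 0 ε, ∀ u, T s u = 0 → u = 0 := by
    have hnhds : {s : ℝ | 0 < s ∧ ∃ u, u ≠ 0 ∧ T s u = 0}ᶜ ∈ nhds (0 : ℝ) :=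
      hfin.isClosed.isOpen_compl.mem_nhds (by simp)
    obtain ⟨ε, hε, hb⟩ := Metric.mem_nhds_iff.1 hnhds
    refine ⟨ε / 2, by positivity, fun s hs u hu => ?_⟩
    by_contra hne
    refine hb (?_ : s ∈ Metric.ball 0 ε) ⟨hs.1, u, hne, hu⟩
    rw [Metric.mem_ball, dist_zero_right, Real.norm_eq_abs, abs_of_pos hs.1]
    linarith [hs.2]
  obtain ⟨d, hd⟩ := hG ε hε
  let U : Set ℝ := T ⁻¹' {S | NegDim S (d + 1)}
  let V : Set ℝ := ⋃ n ∈ Iio (d + 1), T ⁻¹' {S | PosCodim S n}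
  have hU : IsOpen U := (isOpen_negDim _).preimage hTc
  have hV : IsOpen V := isOpen_biUnion fun n _ => (isOpen_posCodim n).preimage hTc
  have hcov : Ioc 0 ε ⊆ U ∪ V := by
    intro s hs
    by_cases h : NegDim (T s) (d + 1)
    · exact Or.inl h
    · obtain ⟨e, he⟩ := hG s hs.1
      obtain ⟨n, hn, hp⟩ := exists_posCodim (hT s) he (hεS s hs) h
      exact Or.inr (mem_biUnion (mem_Iio.2 hn) hp)
  have hUne : (Ioc 0 ε ∩ U).Nonempty := by
    obtain ⟨δ, hδ, hb⟩ := Metric.isOpen_iff.1 hU 0 (h0 (d + 1))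
    have hp : 0 < min ε (δ / 2) := by positivity
    refine ⟨min ε (δ / 2), ⟨hp, min_le_left _ _⟩, hb ?_⟩
    rw [Metric.mem_ball, dist_zero_right, Real.norm_eq_abs, abs_of_pos hp]
    exact (min_le_right _ _).trans_lt (by linarith)
  have hVne : (Ioc 0 ε ∩ V).Nonempty :=
    ⟨ε, ⟨hε, le_rfl⟩, mem_biUnion (mem_Iio.2 d.lt_succ_self) hd.posCodim⟩
  obtain ⟨s, -, hsU, hsV⟩ := isPreconnected_Ioc U V hU hV hcov hUne hVne
  obtain ⟨n, hn, hp⟩ := mem_iUnion₂.1 hsV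
  exact PosCodim.not_negDim hn hp hsU

end Index

section Volterra

open scoped ENNReal Topology

/-- Lebesgue measure on the negative half-line. -/
abbrev halfLine : Measure ℝ := volume.restrict (Iio (0 : ℝ))

/-- The decaying solution `u` of `u' + u = f` on the negative half-line. -/
def lagInt (f : ℝ → ℝ) (x : ℝ) : ℝ := exp (-x) * ∫ y in Iic x, exp y * f y ∂halfLine

/-- The solution `u` of `u' = u - s` on the negative half-line vanishing at `0`. -/
def leadInt (s : ℝ → ℝ) (y : ℝ) : ℝ := exp y * ∫ x in Ioi y, exp (-x) * s x ∂halfLine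

lemma halfLine_restrict_Iic {x : ℝ} (hx : x ≤ 0) :
    halfLine.restrict (Iic x) = volume.restrict (Iic x) := by
  rw [Measure.restrict_restrict measurableSet_Iic]
  refine Measure.restrict_congr_set ?_
  rcases hx.lt_or_eq with h | rfl
  · exact (inter_eq_left.2 (Iic_subset_Iio.2 h)).eventuallyEq
  · rw [inter_eq_right.2 Iio_subset_Iic_self]
    exact Iio_ae_eq_Iic

lemma memLp_exp_halfLine : MemLp exp 2 halfLine := by
  rw [memLp_two_iff_integrable_sq continuous_exp.aestronglyMeasurable]
  have h := (integrableOn_exp_mul_Iic (two_pos (α := ℝ)) 0).mono_set Iio_subset_Iic_self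
  refine h.congr (Eventually.of_forall fun x => ?_)
  simp only [← exp_nat_mul, Nat.cast_ofNat]

lemma integrable_exp_mul {f : ℝ → ℝ} (hf : MemLp f 2 halfLine) :
    Integrable (fun y => exp y * f y) halfLine :=
  memLp_exp_halfLine.integrable_mul hf

lemma integrableOn_exp_neg_mul {s : ℝ → ℝ} (hs : MemLp s 2 halfLine) (y : ℝ) :
    IntegrableOn (fun x => exp (-x) * s x) (Ioi y) halfLine := by
  have h : MemLp (fun x => exp (-x)) 2 (halfLine.restrict (Ioi y)) := by
    rw [memLp_two_iff_integrable_sq (by fun_prop)]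
    have h := ((integrableOn_exp_mul_Ioi (neg_lt_zero.2 (two_pos (α := ℝ))) y))
    refine (h.congr (Eventually.of_forall fun x => ?_)).mono_measure
      (Measure.restrict_mono_measure Measure.restrict_le_self _)
    simp only [← exp_nat_mul, Nat.cast_ofNat, mul_neg, neg_mul]
  exact h.integrable_mul (hs.restrict _)

lemma continuous_lagInt {f : ℝ → ℝ} (hf : MemLp f 2 halfLine) : Continuous (lagInt f) := by
  have hi := integrable_exp_mul hf
  have h : lagInt f = fun x => exp (-x) * ((∫ y in Iic 0, exp y * f y ∂halfLine)
      + ∫ y in (0)..x, exp y * f y ∂halfLine) := by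
    ext x
    rw [← intervalIntegral.integral_Iic_sub_Iic hi.integrableOn hi.integrableOn]
    simp [lagInt]
  rw [h]
  exact (by fun_prop : Continuous fun x : ℝ => exp (-x)).mul
    (continuous_const.add (hi.continuous_primitive 0))

lemma leadInt_zero (s : ℝ → ℝ) : leadInt s 0 = 0 := by
  have : halfLine.restrict (Ioi (0 : ℝ)) = 0 := by
    rw [Measure.restrict_restrict measurableSet_Ioi,
      (by ext y; simp only [mem_inter_iff, mem_Ioi, mem_Iio, mem_empty_iff_false]; grind :
        Ioi (0 : ℝ) ∩ Iio 0 = ∅), Measure.restrict_empty]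
  simp [leadInt, this]

lemma intervalIntegrable_exp_neg_mul {s : ℝ → ℝ} (hs : MemLp s 2 halfLine) (a b : ℝ) :
    IntervalIntegrable (fun x => exp (-x) * s x) halfLine a b := by
  rw [intervalIntegrable_iff]
  exact (integrableOn_exp_neg_mul hs (min a b)).mono_set Ioc_subset_Ioi_self

lemma leadInt_eq {s : ℝ → ℝ} (hs : MemLp s 2 halfLine) (y : ℝ) :
    leadInt s y = -(exp y * ∫ x in (0)..y, exp (-x) * s x ∂halfLine) := by
  have h0 : ∫ x in Ioi (0 : ℝ), exp (-x) * s x ∂halfLine = 0 := by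
    simpa [leadInt] using leadInt_zero s
  have h := intervalIntegral.integral_Ioi_sub_Ioi' (integrableOn_exp_neg_mul hs 0)
    (integrableOn_exp_neg_mul hs y)
  rw [← h, h0]
  simp [leadInt]

lemma continuous_leadInt {s : ℝ → ℝ} (hs : MemLp s 2 halfLine) : Continuous (leadInt s) := by
  rw [funext (leadInt_eq hs)]
  exact (continuous_exp.mul
    (intervalIntegral.continuous_primitive (intervalIntegrable_exp_neg_mul hs) 0)).neg

lemma hasDerivAt_lagInt {f : ℝ → ℝ} (hf : MemLp f 2 halfLine) (hfc : Continuous f) {x : ℝ}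
    (hx : x < 0) : HasDerivAt (lagInt f) (f x - lagInt f x) x := by
  have hi := integrable_exp_mul hf
  have hc : Continuous fun y => exp y * f y := continuous_exp.mul hfc
  have h1 : HasDerivAt (fun z => exp (-z) * ((∫ y in Iic x, exp y * f y)
      + ∫ y in x..z, exp y * f y)) (f x - lagInt f x) x := by
    have h2 := intervalIntegral.integral_hasDerivAt_right (hc.intervalIntegrable x x)
      (hc.stronglyMeasurableAtFilter _ _) hc.continuousAt
    have h3 := ((hasDerivAt_neg x).exp).mul (h2.const_add (∫ y in Iic x, exp y * f y))
    refine h3.congr_deriv ?_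
    simp only [intervalIntegral.integral_same, add_zero, lagInt, halfLine_restrict_Iic hx.le,
      ← mul_assoc, ← exp_add, neg_add_cancel, exp_zero]
    ring
  refine h1.congr_of_eventuallyEq ?_
  filter_upwards [Iio_mem_nhds hx] with z hz
  have hio : ∀ {w : ℝ}, w ≤ 0 → IntegrableOn (fun y => exp y * f y) (Iic w) volume := by
    intro w hw
    rw [IntegrableOn, ← halfLine_restrict_Iic hw]
    exact hi.integrableOn
  rw [← intervalIntegral.integral_Iic_sub_Iic (hio hx.le) (hio (le_of_lt hz)), lagInt,
    halfLine_restrict_Iic (le_of_lt hz)]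
  simp

lemma hasDerivAt_leadInt {s : ℝ → ℝ} (hs : MemLp s 2 halfLine) (hsc : Continuous s) {x : ℝ}
    (hx : x < 0) : HasDerivAt (leadInt s) (leadInt s x - s x) x := by
  have hc : Continuous fun y => exp (-y) * s y := by fun_prop
  have hvol : ∀ {z : ℝ}, z < 0 → leadInt s z = -(exp z * ∫ x in (0)..z, exp (-x) * s x) := by
    intro z hz
    rw [leadInt_eq hs, intervalIntegral.integral_of_ge hz.le,
      intervalIntegral.integral_of_ge hz.le, Measure.restrict_restrict measurableSet_Ioc]
    have : (Ioc z 0 ∩ Iio 0 : Set ℝ) = Ioo z 0 := by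
      ext y; simp only [mem_inter_iff, mem_Ioc, mem_Iio, mem_Ioo]; grind
    rw [this, integral_Ioc_eq_integral_Ioo]
  have h2 := intervalIntegral.integral_hasDerivAt_right (hc.intervalIntegrable 0 x)
    (hc.stronglyMeasurableAtFilter _ _) hc.continuousAt
  have h3 := ((hasDerivAt_exp x).mul h2).neg
  refine (h3.congr_of_eventuallyEq ?_).congr_deriv ?_
  · filter_upwards [Iio_mem_nhds hx] with z hz
    exact hvol hz
  · rw [hvol hx, ← mul_assoc, ← exp_add]
    simp
    ring

lemma lagInt_congr {f g : ℝ → ℝ} (h : f =ᵐ[halfLine] g) : lagInt f = lagInt g := by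
  ext x
  unfold lagInt
  congr 1
  refine integral_congr_ae (ae_restrict_of_ae ?_)
  filter_upwards [h] with y hy
  rw [hy]

lemma leadInt_congr {f g : ℝ → ℝ} (h : f =ᵐ[halfLine] g) : leadInt f = leadInt g := by
  ext x
  unfold leadInt
  congr 1
  refine integral_congr_ae (ae_restrict_of_ae ?_)
  filter_upwards [h] with y hy
  rw [hy]

lemma lagInt_eq_integral (f : ℝ → ℝ) (x : ℝ) :
    lagInt f x = ∫ y in Iic x, exp (y - x) * f y ∂halfLine := by
  rw [lagInt, ← integral_const_mul]
  congr 1 with y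
  rw [← mul_assoc, ← exp_add]
  ring_nf

lemma lintegral_exp_sub_Iic_le (x : ℝ) :
    ∫⁻ y in Iic x, ENNReal.ofReal (exp (y - x)) ∂halfLine ≤ 1 := by
  calc _ ≤ ∫⁻ y in Iic x, ENNReal.ofReal (exp (y - x)) :=
        lintegral_mono' (Measure.restrict_mono_measure Measure.restrict_le_self _) le_rfl
    _ = 1 := by
        have hi : IntegrableOn (fun y => exp (y - x)) (Iic x) := by
          simp_rw [sub_eq_add_neg, exp_add]
          exact (integrableOn_exp_Iic x).mul_const _
        rw [← ofReal_integral_eq_lintegral_ofReal hi (Eventually.of_forall fun y => (exp_pos _).le)]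
        simp_rw [sub_eq_add_neg, exp_add]
        rw [integral_mul_const, integral_exp_Iic, ← exp_add]
        simp

lemma lintegral_exp_sub_Ici_le (y : ℝ) :
    ∫⁻ x in Ici y, ENNReal.ofReal (exp (y - x)) ∂halfLine ≤ 1 := by
  calc _ ≤ ∫⁻ x in Ici y, ENNReal.ofReal (exp (y - x)) :=
        lintegral_mono' (Measure.restrict_mono_measure Measure.restrict_le_self _) le_rfl
    _ = ∫⁻ x in Ioi y, ENNReal.ofReal (exp (y - x)) :=
        setLIntegral_congr Ioi_ae_eq_Ici.symm
    _ = 1 := by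
        have hi : IntegrableOn (fun x => exp (y - x)) (Ioi y) := by
          simp_rw [sub_eq_add_neg, exp_add]
          exact (integrableOn_exp_neg_Ioi y).const_mul _
        rw [← ofReal_integral_eq_lintegral_ofReal hi (Eventually.of_forall fun y => (exp_pos _).le)]
        simp_rw [sub_eq_add_neg, exp_add]
        rw [integral_const_mul, integral_exp_neg_Ioi, ← exp_add]
        simp

lemma enorm_lagInt_sq_le {f : ℝ → ℝ} (hf : AEStronglyMeasurable f halfLine) (x : ℝ) :
    ‖lagInt f x‖ₑ ^ 2 ≤ ∫⁻ y in Iic x, ENNReal.ofReal (exp (y - x)) * ‖f y‖ₑ ^ 2 ∂halfLine := by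
  set κ := halfLine.restrict (Iic x)
  let w : ℝ → ℝ≥0∞ := fun y => ENNReal.ofReal (exp ((y - x) / 2))
  have hw : Measurable w := by fun_prop
  have hw2 : ∀ y, w y ^ 2 = ENNReal.ofReal (exp (y - x)) := fun y => by
    rw [← ENNReal.ofReal_pow (exp_pos _).le, ← exp_nat_mul]
    congr 2
    push_cast
    ring
  have hfm : AEMeasurable (fun y => ‖f y‖ₑ) κ := hf.enorm.mono_measure Measure.restrict_le_self
  have h1 : ‖lagInt f x‖ₑ ≤ ∫⁻ y, (w * fun y => w y * ‖f y‖ₑ) y ∂κ := by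
    rw [lagInt_eq_integral]
    refine (enorm_integral_le_lintegral_enorm _).trans (le_of_eq (lintegral_congr fun y => ?_))
    rw [enorm_mul, Pi.mul_apply, ← mul_assoc, ← sq, hw2, Real.enorm_of_nonneg (exp_pos _).le]
  have h2 := ENNReal.lintegral_mul_le_Lp_mul_Lq κ Real.HolderConjugate.two_two
    hw.aemeasurable (hw.aemeasurable.mul hfm)
  have h3 : ∀ t : ℝ≥0∞, (t ^ (1 / 2 : ℝ)) ^ 2 = t := fun t => by
    rw [← ENNReal.rpow_natCast, ← ENNReal.rpow_mul]; norm_num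
  calc ‖lagInt f x‖ₑ ^ 2 ≤ ((∫⁻ y, w y ^ (2 : ℝ) ∂κ) ^ (1 / 2 : ℝ)
        * (∫⁻ y, (w y * ‖f y‖ₑ) ^ (2 : ℝ) ∂κ) ^ (1 / 2 : ℝ)) ^ 2 := by
        gcongr; exact h1.trans h2
    _ = (∫⁻ y, w y ^ 2 ∂κ) * ∫⁻ y, w y ^ 2 * ‖f y‖ₑ ^ 2 ∂κ := by
        rw [mul_pow, h3, h3]
        simp only [ENNReal.rpow_two, mul_pow]
    _ ≤ 1 * ∫⁻ y, w y ^ 2 * ‖f y‖ₑ ^ 2 ∂κ := by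
        gcongr
        simp_rw [hw2]
        exact lintegral_exp_sub_Iic_le x
    _ = _ := by rw [one_mul]; simp_rw [hw2]

lemma lintegral_lagInt_sq_le {f : ℝ → ℝ} (hf : AEStronglyMeasurable f halfLine) :
    ∫⁻ x, ‖lagInt f x‖ₑ ^ 2 ∂halfLine ≤ ∫⁻ y, ‖f y‖ₑ ^ 2 ∂halfLine := by
  have hfm : AEMeasurable (fun p : ℝ × ℝ => ‖f p.2‖ₑ) (halfLine.prod halfLine) :=
    hf.enorm.comp_quasiMeasurePreserving Measure.quasiMeasurePreserving_snd
  calc ∫⁻ x, ‖lagInt f x‖ₑ ^ 2 ∂halfLine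
      ≤ ∫⁻ x, ∫⁻ y, (Iic x).indicator
          (fun y => ENNReal.ofReal (exp (y - x)) * ‖f y‖ₑ ^ 2) y ∂halfLine ∂halfLine := by
        refine lintegral_mono fun x => ?_
        rw [lintegral_indicator measurableSet_Iic]
        exact enorm_lagInt_sq_le hf x
    _ = ∫⁻ y, ∫⁻ x, (Iic x).indicator
          (fun y => ENNReal.ofReal (exp (y - x)) * ‖f y‖ₑ ^ 2) y ∂halfLine ∂halfLine := by
        refine lintegral_lintegral_swap ?_
        have : (Function.uncurry fun x y => (Iic x).indicator
            (fun y => ENNReal.ofReal (exp (y - x)) * ‖f y‖ₑ ^ 2) y)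
            = {p : ℝ × ℝ | p.2 ≤ p.1}.indicator
              fun p => ENNReal.ofReal (exp (p.2 - p.1)) * ‖f p.2‖ₑ ^ 2 := by
          ext ⟨x, y⟩
          simp [indicator]
        rw [this]
        exact (((by fun_prop : Measurable fun p : ℝ × ℝ =>
          ENNReal.ofReal (exp (p.2 - p.1))).aemeasurable).mul (hfm.pow_const 2)).indicator
          (measurableSet_le measurable_snd measurable_fst)
    _ = ∫⁻ y, (∫⁻ x in Ici y, ENNReal.ofReal (exp (y - x)) ∂halfLine) * ‖f y‖ₑ ^ 2 ∂halfLine := by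
        refine lintegral_congr fun y => ?_
        rw [← lintegral_mul_const _ (by fun_prop), ← lintegral_indicator measurableSet_Ici]
        refine lintegral_congr fun x => ?_
        simp [indicator]
    _ ≤ ∫⁻ y, 1 * ‖f y‖ₑ ^ 2 ∂halfLine := by
        gcongr with y
        exact lintegral_exp_sub_Ici_le y
    _ = _ := by simp

lemma eLpNorm_lagInt_le {f : ℝ → ℝ} (hf : AEStronglyMeasurable f halfLine) :
    eLpNorm (lagInt f) 2 halfLine ≤ eLpNorm f 2 halfLine := by
  have h : ∀ g : ℝ → ℝ, eLpNorm g 2 halfLine ^ 2 = ∫⁻ x, ‖g x‖ₑ ^ 2 ∂halfLine := fun g => by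
    simpa using eLpNorm_nnreal_pow_eq_lintegral (f := g) (μ := halfLine) (two_ne_zero (α := NNReal))
  rw [← ENNReal.pow_le_pow_left_iff two_ne_zero, h, h]
  exact lintegral_lagInt_sq_le hf

lemma memLp_lagInt {f : ℝ → ℝ} (hf : MemLp f 2 halfLine) : MemLp (lagInt f) 2 halfLine :=
  ⟨(continuous_lagInt hf).aestronglyMeasurable, (eLpNorm_lagInt_le hf.1).trans_lt hf.2⟩

/-- Square integrable functions on the negative half-line. -/
abbrev HalfL2 : Type := Lp ℝ 2 halfLine

lemma lagInt_add {f g : ℝ → ℝ} (hf : MemLp f 2 halfLine) (hg : MemLp g 2 halfLine) :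
    lagInt (f + g) = lagInt f + lagInt g := by
  ext x
  simp only [lagInt, Pi.add_apply, mul_add]
  rw [integral_add (integrable_exp_mul hf).integrableOn (integrable_exp_mul hg).integrableOn,
    mul_add]

lemma lagInt_smul (c : ℝ) (f : ℝ → ℝ) : lagInt (c • f) = c • lagInt f := by
  ext x
  simp only [lagInt, Pi.smul_apply, smul_eq_mul, mul_left_comm _ c]
  rw [integral_const_mul, mul_left_comm]

/-- `lagInt` on square integrable classes. -/
def lagLp (f : HalfL2) : HalfL2 := (memLp_lagInt (Lp.memLp f)).toLp

lemma coeFn_lagLp (f : HalfL2) : lagLp f =ᵐ[halfLine] lagInt f := MemLp.coeFn_toLp _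

lemma lagLp_add (f g : HalfL2) : lagLp (f + g) = lagLp f + lagLp g := by
  apply Lp.ext
  filter_upwards [coeFn_lagLp f, coeFn_lagLp g, coeFn_lagLp (f + g),
    Lp.coeFn_add (lagLp f) (lagLp g)] with x h1 h2 h3 h4
  rw [h3, h4, Pi.add_apply, h1, h2, lagInt_congr (Lp.coeFn_add f g),
    lagInt_add (Lp.memLp f) (Lp.memLp g), Pi.add_apply]

lemma lagLp_smul (c : ℝ) (f : HalfL2) : lagLp (c • f) = c • lagLp f := by
  apply Lp.ext
  filter_upwards [coeFn_lagLp f, coeFn_lagLp (c • f), Lp.coeFn_smul c (lagLp f)] with x h1 h2 h3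
  rw [h2, h3, Pi.smul_apply, h1, lagInt_congr (Lp.coeFn_smul c f), lagInt_smul, Pi.smul_apply]

lemma norm_lagLp_le (f : HalfL2) : ‖lagLp f‖ ≤ 1 * ‖f‖ := by
  rw [one_mul, lagLp, Lp.norm_toLp, Lp.norm_def]
  exact ENNReal.toReal_mono (Lp.eLpNorm_ne_top f) (eLpNorm_lagInt_le (Lp.aestronglyMeasurable f))

/-- `lagInt` as a bounded operator. -/
def lag : HalfL2 →L[ℝ] HalfL2 :=
  LinearMap.mkContinuous ⟨⟨lagLp, lagLp_add⟩, lagLp_smul⟩ 1 norm_lagLp_le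

lemma coeFn_lag (f : HalfL2) : lag f =ᵐ[halfLine] lagInt f := coeFn_lagLp f

end Volterra

section LagAdjoint

open scoped ENNReal Topology InnerProductSpace

lemma integral_lagInt_mul {f h : ℝ → ℝ} (hf : MemLp f 2 halfLine) (hh : MemLp h 2 halfLine) :
    Integrable (fun y => f y * leadInt h y) halfLine ∧
    ∫ x, lagInt f x * h x ∂halfLine = ∫ y, f y * leadInt h y ∂halfLine := by
  set F : ℝ → ℝ → ℝ := fun x y => (Iic x).indicator (fun y => exp (y - x) * f y) y * h x with hF
  have hFi : Function.uncurry F = fun p => {p : ℝ × ℝ | p.2 ≤ p.1}.indicator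
      (fun p => exp (p.2 - p.1)) p * f p.2 * h p.1 := by
    ext ⟨x, y⟩
    simp only [Function.uncurry, hF, indicator, mem_Iic, mem_ofPred_eq]
    split_ifs <;> ring
  have hmeas : AEStronglyMeasurable (Function.uncurry F) (halfLine.prod halfLine) := by
    rw [hFi]
    exact (((by fun_prop : Measurable fun p : ℝ × ℝ => exp (p.2 - p.1)).indicator
      (measurableSet_le measurable_snd measurable_fst)).aestronglyMeasurable.mul
      (hf.1.comp_quasiMeasurePreserving Measure.quasiMeasurePreserving_snd)).mul
      (hh.1.comp_quasiMeasurePreserving Measure.quasiMeasurePreserving_fst)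
  have hx : ∀ x, ∫ y, F x y ∂halfLine = lagInt f x * h x := fun x => by
    simp only [hF]
    rw [integral_mul_const, integral_indicator measurableSet_Iic, lagInt_eq_integral]
  have hnorm : ∀ x, ∫ y, ‖F x y‖ ∂halfLine = lagInt (fun y => |f y|) x * |h x| := fun x => by
    rw [lagInt_eq_integral, ← integral_indicator measurableSet_Iic, ← integral_mul_const]
    congr 1 with y
    simp only [hF, norm_mul, norm_eq_abs, indicator]
    split_ifs <;> simp [abs_mul]
  have hy : ∀ y, ∫ x, F x y ∂halfLine = f y * leadInt h y := fun y => by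
    have : ∀ x, F x y = f y * (exp y * (Ici y).indicator (fun x => exp (-x) * h x) x) := fun x => by
      simp only [hF, indicator, mem_Iic, mem_Ici]
      split_ifs
      · rw [sub_eq_add_neg, exp_add]; ring
      · ring
    simp_rw [this]
    rw [integral_const_mul, integral_const_mul, integral_indicator measurableSet_Ici, leadInt]
    congr 2
    exact setIntegral_congr_set (ae_restrict_of_ae Ioi_ae_eq_Ici.symm)
  have hint : Integrable (Function.uncurry F) (halfLine.prod halfLine) := by
    rw [integrable_prod_iff hmeas]
    constructor
    · refine Eventually.of_forall fun x => ?_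
      have : IntegrableOn (fun y => exp (y - x) * f y) (Iic x) halfLine := by
        simp_rw [sub_eq_add_neg, exp_add, mul_right_comm]
        exact ((integrable_exp_mul hf).mul_const _).integrableOn
      exact (this.integrable_indicator measurableSet_Iic).mul_const (h x)
    · simp only [Function.uncurry, hnorm]
      exact (memLp_lagInt hf.abs).integrable_mul hh.abs
  refine ⟨?_, ?_⟩
  · refine hint.integral_prod_right.congr (Eventually.of_forall fun y => ?_)
    exact hy y
  · simp_rw [← hx, ← hy]
    exact integral_integral_swap hint

lemma inner_halfL2 (f h : HalfL2) : ⟪f, h⟫_ℝ = ∫ x, f x * h x ∂halfLine := by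
  rw [L2.inner_def]
  congr 1 with x
  simp [mul_comm]

lemma coeFn_adjoint_lag (h : HalfL2) : lag.adjoint h =ᵐ[halfLine] leadInt h := by
  have key : ∀ A, MeasurableSet A → halfLine A < ∞ →
      IntegrableOn (leadInt h) A halfLine ∧
        ∫ x in A, lag.adjoint h x ∂halfLine = ∫ x in A, leadInt h x ∂halfLine := by
    intro A hA hAf
    set e : HalfL2 := indicatorConstLp 2 hA hAf.ne 1
    have he : e =ᵐ[halfLine] A.indicator fun _ => (1 : ℝ) := indicatorConstLp_coeFn
    obtain ⟨h1, h2⟩ := integral_lagInt_mul (Lp.memLp e) (Lp.memLp h)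
    have h3 : ∀ w : ℝ → ℝ, (fun y => e y * w y) =ᵐ[halfLine] A.indicator w := fun w => by
      filter_upwards [he] with y hy
      rw [hy]
      simp [indicator]
    refine ⟨(integrable_indicator_iff hA).1 (h1.congr (h3 _)), ?_⟩
    calc ∫ x in A, lag.adjoint h x ∂halfLine = ⟪e, lag.adjoint h⟫_ℝ := by
          rw [inner_halfL2, integral_congr_ae (h3 _), integral_indicator hA]
      _ = ∫ x, lagInt e x * h x ∂halfLine := by
          rw [ContinuousLinearMap.adjoint_inner_right, inner_halfL2]
          refine integral_congr_ae ?_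
          filter_upwards [coeFn_lag e] with x hx
          rw [hx]
      _ = _ := by rw [h2, integral_congr_ae (h3 _), integral_indicator hA]
  refine ae_eq_of_forall_setIntegral_eq_of_sigmaFinite
    (fun A _ hAf => integrableOn_Lp_of_measure_ne_top _ one_le_two hAf.ne)
    (fun A hA hAf => (key A hA hAf).1) (fun A hA hAf => (key A hA hAf).2)

end LagAdjoint

section FormOperator

open scoped ENNReal Topology InnerProductSpace

lemma exists_mulOperator {w : ℝ → ℝ} {C : ℝ} (hw : Continuous w) (hC : ∀ x < 0, |w x| ≤ C) :
    ∃ M : HalfL2 →L[ℝ] HalfL2, ∀ f, M f =ᵐ[halfLine] fun x => w x * f x := by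
  have hC' : ∀ᵐ x ∂halfLine, |w x| ≤ C := by
    filter_upwards [ae_restrict_mem measurableSet_Iio] with x hx using hC x hx
  have hle : ∀ f : HalfL2, ∀ᵐ x ∂halfLine, ‖w x * f x‖ ≤ C * ‖f x‖ := fun f => by
    filter_upwards [hC'] with x hx
    rw [norm_mul]
    gcongr
    exact hx
  have hmem : ∀ f : HalfL2, MemLp (fun x => w x * f x) 2 halfLine := fun f =>
    (Lp.memLp f).of_le_mul (hw.aestronglyMeasurable.mul (Lp.aestronglyMeasurable f)) (hle f)
  let N : HalfL2 → HalfL2 := fun f => (hmem f).toLp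
  have hN : ∀ f, N f =ᵐ[halfLine] fun x => w x * f x := fun f => (hmem f).coeFn_toLp
  refine ⟨LinearMap.mkContinuous ⟨⟨N, fun f g => ?_⟩, fun c f => ?_⟩ C fun f => ?_, hN⟩
  · apply Lp.ext
    filter_upwards [hN f, hN g, hN (f + g), Lp.coeFn_add f g, Lp.coeFn_add (N f) (N g)]
      with x h1 h2 h3 h4 h5
    rw [h3, h4, h5, Pi.add_apply, Pi.add_apply, h1, h2, mul_add]
  · apply Lp.ext
    filter_upwards [hN f, hN (c • f), Lp.coeFn_smul c f, Lp.coeFn_smul c (N f)] with x h1 h2 h3 h4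
    simp only [RingHom.id_apply]
    rw [h2, h3, h4, Pi.smul_apply, Pi.smul_apply, h1, smul_eq_mul, smul_eq_mul]
    ring
  · refine Lp.norm_le_mul_norm_of_ae_le_mul ?_
    filter_upwards [hN f, hle f] with x h1 h2
    change ‖N f x‖ ≤ _
    rwa [h1]

/-- The profile generated by `f`: the decaying solution of `φ'' + 2 φ' + φ = f`. -/
def profile : HalfL2 →L[ℝ] HalfL2 := lag ∘L lag

/-- The derivative of the profile generated by `f`. -/
def profile₁ : HalfL2 →L[ℝ] HalfL2 := lag - lag ∘L lag

/-- The second derivative of the profile generated by `f`, plus `k ^ 2` times the profile. -/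
def profileBend (k : ℝ) : HalfL2 →L[ℝ] HalfL2 :=
  ContinuousLinearMap.id ℝ HalfL2 - (2 : ℝ) • lag + (1 + k ^ 2) • (lag ∘L lag)

/-- The operator of the quadratic form whose kernel is the solution set of the eigenvalue
problem with characteristic value `s`; `M` stands for multiplication by the density. -/
def formOp (μ g k : ℝ) (M : HalfL2 →L[ℝ] HalfL2) (s : ℝ) : HalfL2 →L[ℝ] HalfL2 :=
  s ^ 2 • (k ^ 2 • (profile.adjoint ∘L M ∘L profile) + profile₁.adjoint ∘L M ∘L profile₁)
    + (s * μ) • ((profileBend k).adjoint ∘L profileBend k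
      + (4 * k ^ 2) • (profile₁.adjoint ∘L profile₁))
    + (g * k ^ 2) • (profile₁.adjoint ∘L M ∘L profile + profile.adjoint ∘L M ∘L profile₁)

lemma inner_formOp (μ g k : ℝ) (M : HalfL2 →L[ℝ] HalfL2) (s : ℝ) (f h : HalfL2) :
    ⟪formOp μ g k M s f, h⟫_ℝ =
      s ^ 2 * (k ^ 2 * ⟪M (profile f), profile h⟫_ℝ + ⟪M (profile₁ f), profile₁ h⟫_ℝ)
      + s * μ * (⟪profileBend k f, profileBend k h⟫_ℝ + 4 * k ^ 2 * ⟪profile₁ f, profile₁ h⟫_ℝ)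
      + g * k ^ 2 * (⟪M (profile f), profile₁ h⟫_ℝ + ⟪M (profile₁ f), profile h⟫_ℝ) := by
  simp only [formOp, _root_.add_apply, _root_.smul_apply, ContinuousLinearMap.comp_apply,
    inner_add_left, real_inner_smul_left, ContinuousLinearMap.adjoint_inner_left]

lemma continuous_formOp (μ g k : ℝ) (M : HalfL2 →L[ℝ] HalfL2) : Continuous (formOp μ g k M) := by
  unfold formOp
  fun_prop

lemma formOp_isSymmetric (μ g k : ℝ) {M : HalfL2 →L[ℝ] HalfL2}
    (hM : ∀ f h, ⟪M f, h⟫_ℝ = ⟪f, M h⟫_ℝ) (s : ℝ) : (formOp μ g k M s).IsSymmetric := by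
  intro f h
  change ⟪formOp μ g k M s f, h⟫_ℝ = ⟪f, formOp μ g k M s h⟫_ℝ
  rw [← real_inner_comm f, inner_formOp, inner_formOp]
  have h2 : ∀ f h, ⟪M f, h⟫_ℝ = ⟪M h, f⟫_ℝ := fun f h => by rw [hM, real_inner_comm]
  rw [h2 (profile f) (profile h), h2 (profile₁ f) (profile₁ h), h2 (profile f) (profile₁ h),
    h2 (profile₁ f) (profile h), real_inner_comm (profile₁ f) (profile₁ h),
    real_inner_comm (profileBend k f)]
  ring

lemma mulOperator_symmetric {w : ℝ → ℝ} {M : HalfL2 →L[ℝ] HalfL2}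
    (hM : ∀ f, M f =ᵐ[halfLine] fun x => w x * f x) (f h : HalfL2) : ⟪M f, h⟫_ℝ = ⟪f, M h⟫_ℝ := by
  rw [inner_halfL2, inner_halfL2]
  refine integral_congr_ae ?_
  filter_upwards [hM f, hM h] with x h1 h2
  rw [h1, h2]
  ring

/-- The continuous representative of `profile f`. -/
def prof (f : ℝ → ℝ) : ℝ → ℝ := lagInt (lagInt f)

/-- The continuous representative of `profile₁ f`. -/
def prof₁ (f : ℝ → ℝ) : ℝ → ℝ := lagInt f - prof f

variable {f : ℝ → ℝ}

lemma memLp_prof (hf : MemLp f 2 halfLine) : MemLp (prof f) 2 halfLine :=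
  memLp_lagInt (memLp_lagInt hf)

lemma memLp_prof₁ (hf : MemLp f 2 halfLine) : MemLp (prof₁ f) 2 halfLine :=
  (memLp_lagInt hf).sub (memLp_prof hf)

lemma continuous_prof (hf : MemLp f 2 halfLine) : Continuous (prof f) :=
  continuous_lagInt (memLp_lagInt hf)

lemma continuous_prof₁ (hf : MemLp f 2 halfLine) : Continuous (prof₁ f) :=
  (continuous_lagInt hf).sub (continuous_prof hf)

lemma hasDerivAt_prof (hf : MemLp f 2 halfLine) {x : ℝ} (hx : x < 0) :
    HasDerivAt (prof f) (prof₁ f x) x :=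
  hasDerivAt_lagInt (memLp_lagInt hf) (continuous_lagInt hf) hx

lemma coeFn_profile (f : HalfL2) : profile f =ᵐ[halfLine] prof f := by
  have h := coeFn_lag (lag f)
  rwa [lagInt_congr (coeFn_lag f)] at h

lemma coeFn_profile₁ (f : HalfL2) : profile₁ f =ᵐ[halfLine] prof₁ f := by
  filter_upwards [coeFn_lag f, coeFn_profile f, Lp.coeFn_sub (lag f) (profile f)] with x h1 h2 h3
  change (lag f - profile f : HalfL2) x = _
  rw [h3, Pi.sub_apply, h1, h2, prof₁, Pi.sub_apply]

lemma coeFn_profileBend (k : ℝ) (f : HalfL2) : profileBend k f =ᵐ[halfLine]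
    fun x => f x - 2 * lagInt f x + (1 + k ^ 2) * prof f x := by
  filter_upwards [coeFn_lag f, coeFn_profile f, Lp.coeFn_sub f ((2 : ℝ) • lag f),
    Lp.coeFn_smul (2 : ℝ) (lag f), Lp.coeFn_smul (1 + k ^ 2) (profile f),
    Lp.coeFn_add (f - (2 : ℝ) • lag f) ((1 + k ^ 2) • profile f)] with x h1 h2 h3 h4 h5 h6
  change (f - (2 : ℝ) • lag f + (1 + k ^ 2) • profile f : HalfL2) x = _
  rw [h6, Pi.add_apply, h3, Pi.sub_apply, h4, h5, Pi.smul_apply, Pi.smul_apply, h1, h2,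
    smul_eq_mul, smul_eq_mul]

lemma tendsto_sq_atBot {u u' : ℝ → ℝ} (hu : MemLp u 2 halfLine) (hu' : MemLp u' 2 halfLine)
    (hd : ∀ x < 0, HasDerivAt u (u' x) x) : Tendsto u atBot (𝓝 0) := by
  have hd2 : ∀ x ∈ Iio (0 : ℝ), HasDerivAt (fun x => u x ^ 2) (2 * (u x * u' x)) x := fun x hx => by
    exact ((hd x hx).fun_pow 2).congr_deriv (by norm_num [mul_assoc])
  have hI : Iic (-1 : ℝ) ⊆ Iio 0 := Iic_subset_Iio.2 (by norm_num)
  have h := tendsto_zero_of_hasDerivAt_of_integrableOn_Iic (a := -1)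
    (fun x hx => hd2 x (hI hx))
    (IntegrableOn.mono_set (t := Iio 0) ((hu.integrable_mul hu').const_mul 2) hI)
    (IntegrableOn.mono_set (t := Iio 0) hu.integrable_sq hI)
  rw [tendsto_zero_iff_abs_tendsto_zero]
  have h2 := (continuous_sqrt.tendsto 0).comp h
  rw [sqrt_zero] at h2
  refine h2.congr fun x => ?_
  simp [sqrt_sq_eq_abs]

lemma tendsto_prof (hf : MemLp f 2 halfLine) : Tendsto (prof f) atBot (𝓝 0) :=
  tendsto_sq_atBot (memLp_prof hf) (memLp_prof₁ hf) fun _ hx => hasDerivAt_prof hf hx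

end FormOperator

section Coercivity

open scoped ENNReal Topology InnerProductSpace

/-- A density profile on the negative half-line, increasing from `m` to `p` on `[-a, 0]`, extended
by a constant to the right, with logarithmic derivative at most `L`. -/
structure IsDensity (ρ : ℝ → ℝ) (a m p L : ℝ) : Prop where
  smooth : ContDiff ℝ (⊤ : ℕ∞) ρ
  a_pos : 0 < a
  m_pos : 0 < m
  lower : ∀ x < 0, m ≤ ρ x
  upper : ∀ x < 0, ρ x ≤ p
  deriv_nonneg : ∀ x < 0, 0 ≤ deriv ρ x
  deriv_le : ∀ x < 0, deriv ρ x ≤ L * ρ x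
  left : ∀ x ≤ -a, ρ x = m
  right : ∀ x, 0 ≤ x → ρ x = p
  support : tsupport (deriv ρ) = Icc (-a) 0

variable {ρ : ℝ → ℝ} {a m p L μ g k : ℝ}

lemma IsDensity.L_nonneg (hρ : IsDensity ρ a m p L) : 0 ≤ L := by
  have h1 := hρ.deriv_nonneg (-1) (by norm_num)
  have h2 := hρ.deriv_le (-1) (by norm_num)
  have h3 := hρ.lower (-1) (by norm_num)
  have h4 := hρ.m_pos
  by_contra h
  nlinarith

lemma IsDensity.p_pos (hρ : IsDensity ρ a m p L) : 0 < p :=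
  hρ.m_pos.trans_le ((hρ.lower (-1) (by norm_num)).trans (hρ.upper (-1) (by norm_num)))

lemma IsDensity.deriv_le_const (hρ : IsDensity ρ a m p L) {x : ℝ} (hx : x < 0) :
    deriv ρ x ≤ L * p :=
  (hρ.deriv_le x hx).trans (mul_le_mul_of_nonneg_left (hρ.upper x hx) hρ.L_nonneg)

lemma IsDensity.deriv_eq_zero (hρ : IsDensity ρ a m p L) {x : ℝ} (hx : x < -a) :
    deriv ρ x = 0 := by
  refine image_eq_zero_of_notMem_tsupport (f := deriv ρ) ?_
  rw [hρ.support, mem_Icc]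
  grind

lemma IsDensity.abs_le (hρ : IsDensity ρ a m p L) {x : ℝ} (hx : x < 0) : |ρ x| ≤ p := by
  rw [abs_of_pos (hρ.m_pos.trans_le (hρ.lower x hx))]
  exact hρ.upper x hx

lemma IsDensity.continuous_deriv (hρ : IsDensity ρ a m p L) : Continuous (deriv ρ) :=
  hρ.smooth.continuous_deriv (by simp)

lemma IsDensity.hasDerivAt (hρ : IsDensity ρ a m p L) (x : ℝ) : HasDerivAt ρ (deriv ρ x) x :=
  (hρ.smooth.differentiable (by simp) x).hasDerivAt

lemma integrable_weight_mul {w u v : ℝ → ℝ} {C : ℝ} (hw : Continuous w)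
    (hC : ∀ x < 0, |w x| ≤ C) (hu : MemLp u 2 halfLine) (hv : MemLp v 2 halfLine) :
    Integrable (fun x => w x * (u x * v x)) halfLine :=
  (hu.integrable_mul hv).bdd_mul hw.aestronglyMeasurable
    ((ae_restrict_mem measurableSet_Iio).mono fun x hx => hC x hx)

lemma IsDensity.integrable_mul (hρ : IsDensity ρ a m p L) {u v : ℝ → ℝ}
    (hu : MemLp u 2 halfLine) (hv : MemLp v 2 halfLine) :
    Integrable (fun x => ρ x * (u x * v x)) halfLine :=
  integrable_weight_mul hρ.smooth.continuous (fun _ hx => hρ.abs_le hx) hu hv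

lemma IsDensity.integrable_deriv_mul (hρ : IsDensity ρ a m p L) {u v : ℝ → ℝ}
    (hu : MemLp u 2 halfLine) (hv : MemLp v 2 halfLine) :
    Integrable (fun x => deriv ρ x * (u x * v x)) halfLine :=
  integrable_weight_mul hρ.continuous_deriv (C := L * p) (fun x hx => by
    rw [abs_of_nonneg (hρ.deriv_nonneg x hx)]
    exact hρ.deriv_le_const hx) hu hv

lemma IsDensity.integral_boundary (hρ : IsDensity ρ a m p L) {f : ℝ → ℝ}
    (hf : MemLp f 2 halfLine) :
    (∫ x, deriv ρ x * (prof f x * prof f x) ∂halfLine)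
      + 2 * ∫ x, ρ x * (prof f x * prof₁ f x) ∂halfLine = p * prof f 0 ^ 2 := by
  have h1 := hρ.integrable_deriv_mul (memLp_prof hf) (memLp_prof hf)
  have h2 := (hρ.integrable_mul (memLp_prof hf) (memLp_prof₁ hf)).const_mul 2
  rw [← integral_const_mul, ← integral_add h1 h2]
  have hd : ∀ x ∈ Iio (0 : ℝ), HasDerivAt (fun x => ρ x * prof f x ^ 2)
      (deriv ρ x * (prof f x * prof f x) + 2 * (ρ x * (prof f x * prof₁ f x))) x := fun x hx => by
    refine ((hρ.hasDerivAt x).fun_mul ((hasDerivAt_prof hf hx).fun_pow 2)).congr_deriv ?_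
    push_cast
    ring
  have hint : IntegrableOn (fun x => deriv ρ x * (prof f x * prof f x)
      + 2 * (ρ x * (prof f x * prof₁ f x))) (Iic 0) volume :=
    (integrableOn_Iic_iff_integrableOn_Iio).2 (h1.add h2)
  have hlim : Tendsto (fun x => ρ x * prof f x ^ 2) atBot (𝓝 0) := by
    have := ((tendsto_prof hf).pow 2).const_mul m
    simp only [ne_eq, OfNat.ofNat_ne_zero, not_false_eq_true, zero_pow, mul_zero] at this
    refine this.congr' ?_
    filter_upwards [eventually_le_atBot (-a)] with x hx
    rw [hρ.left x hx]
  have h3 := integral_Iic_of_hasDerivAt_of_tendsto (f := fun x => ρ x * prof f x ^ 2)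
    ((hρ.smooth.continuous.mul ((continuous_prof hf).pow 2)).continuousWithinAt) hd hint hlim
  rw [integral_Iic_eq_integral_Iio, hρ.right 0 le_rfl, sub_zero] at h3
  exact h3

lemma sq_sub_le_mul_norm_sq (f : HalfL2) {x y : ℝ} (hyx : y ≤ x) (hx : x < 0) :
    (prof f x - prof f y) ^ 2 ≤ (x - y) * ‖profile₁ f‖ ^ 2 := by
  have hfin : halfLine (Ioc y x) ≠ ∞ := (measure_lt_top_of_subset
    (Subset.refl _) (by
      exact ((Measure.restrict_apply_le _ _).trans_lt measure_Ioc_lt_top).ne)).ne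
  have hres : halfLine.restrict (Ioc y x) = volume.restrict (Ioc y x) := by
    rw [Measure.restrict_restrict measurableSet_Ioc, inter_eq_left.2]
    exact fun z hz => hz.2.trans_lt hx
  have h1 : prof f x - prof f y = ⟪indicatorConstLp 2 measurableSet_Ioc hfin 1, profile₁ f⟫_ℝ := by
    rw [L2.inner_indicatorConstLp_one, integral_congr_ae (ae_restrict_of_ae (coeFn_profile₁ f)),
      hres, ← intervalIntegral.integral_of_le hyx]
    refine (intervalIntegral.integral_eq_sub_of_hasDerivAt (fun z hz => ?_)
      ((continuous_prof₁ (Lp.memLp f)).intervalIntegrable _ _)).symm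
    rw [uIcc_of_le hyx] at hz
    exact hasDerivAt_prof (Lp.memLp f) (hz.2.trans_lt hx)
  have h2 : ‖(indicatorConstLp 2 measurableSet_Ioc hfin 1 : HalfL2)‖ ^ 2 = x - y := by
    rw [← real_inner_self_eq_norm_sq, L2.inner_indicatorConstLp_one,
      integral_congr_ae (ae_restrict_of_ae indicatorConstLp_coeFn), hres,
      setIntegral_congr_fun (g := fun _ => (1 : ℝ)) measurableSet_Ioc]
    · simp [hyx]
    · intro z hz
      simp only [indicator_of_mem hz]
  rw [h1, ← h2, ← mul_pow, ← sq_abs]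
  gcongr
  exact abs_real_inner_le_norm _ _

/-- Evaluation of `lagInt` at a point, as a bounded functional. -/
def lagEval (x : ℝ) : HalfL2 →L[ℝ] ℝ :=
  exp (-x) • innerSL ℝ ((memLp_exp_halfLine.indicator (measurableSet_Iic (a := x))).toLp)

lemma lagEval_apply (x : ℝ) (f : HalfL2) : lagEval x f = lagInt f x := by
  simp only [lagEval, _root_.smul_apply, innerSL_apply_apply, smul_eq_mul, lagInt]
  rw [inner_halfL2, ← integral_indicator measurableSet_Iic]
  congr 1
  refine integral_congr_ae ?_
  filter_upwards [(memLp_exp_halfLine.indicator (measurableSet_Iic (a := x))).coeFn_toLp] with y hy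
  rw [hy]
  simp [indicator]

lemma exists_sq_prof_le (ha : 0 < a) {ε : ℝ} (hε : 0 < ε) :
    ∃ (n : ℕ) (ℓ : HalfL2 →L[ℝ] (Fin n → ℝ)), ∀ f : HalfL2, ∀ x ∈ Ico (-a) 0,
      prof f x ^ 2 ≤ ε * ‖f‖ ^ 2 + 2 * ‖ℓ f‖ ^ 2 := by
  obtain ⟨n, hn⟩ := exists_nat_gt (2 * a * ‖profile₁‖ ^ 2 / ε)
  have hn0 : (0 : ℝ) < n := lt_of_le_of_lt (by positivity) hn
  have hh : 0 < a / n := by positivity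
  refine ⟨n, ContinuousLinearMap.pi fun i => lagEval (-a + i * (a / n)) ∘L lag, fun f x hx => ?_⟩
  have hi0 : 0 ≤ (x + a) / (a / n) := div_nonneg (by linarith [hx.1]) hh.le
  have hin : ⌊(x + a) / (a / n)⌋₊ < n := by
    rw [Nat.floor_lt hi0, div_lt_iff₀ hh]
    field_simp
    linarith [hx.2]
  set i : Fin n := ⟨⌊(x + a) / (a / n)⌋₊, hin⟩
  set y := -a + (i : ℝ) * (a / n) with hy
  have h1 : y ≤ x := by
    have := (le_div_iff₀ hh).1 (Nat.floor_le hi0)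
    grind
  have h2 : x - y ≤ a / n := by
    have := (div_lt_iff₀ hh).1 (Nat.lt_floor_add_one ((x + a) / (a / n)))
    grind
  set ℓ : HalfL2 →L[ℝ] (Fin n → ℝ) :=
    ContinuousLinearMap.pi fun i => lagEval (-a + i * (a / n)) ∘L lag
  have h3 : |prof f y| ≤ ‖ℓ f‖ := by
    have : ℓ f i = prof f y := by
      change lagEval y (lag f) = _
      rw [lagEval_apply, lagInt_congr (coeFn_lag f), prof]
    rw [← this]
    exact norm_le_pi_norm (ℓ f) i
  have h4 := sq_sub_le_mul_norm_sq f h1 hx.2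
  have h5 : prof f y ^ 2 ≤ ‖ℓ f‖ ^ 2 := by
    rw [← sq_abs]
    gcongr
  have h6 : ‖profile₁ f‖ ^ 2 ≤ ‖profile₁‖ ^ 2 * ‖f‖ ^ 2 := by
    rw [← mul_pow]
    gcongr
    exact profile₁.le_opNorm f
  have h7 : 2 * (a / n) * ‖profile₁‖ ^ 2 ≤ ε := by
    rw [div_lt_iff₀ hε] at hn
    rw [mul_div_assoc', div_mul_eq_mul_div, div_le_iff₀ hn0]
    linarith
  have h8 : (x - y) * ‖profile₁ f‖ ^ 2 ≤ (a / n) * (‖profile₁‖ ^ 2 * ‖f‖ ^ 2) := by gcongr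
  nlinarith [sq_nonneg (prof f x - 2 * prof f y), mul_le_mul_of_nonneg_right h7 (sq_nonneg ‖f‖)]

lemma IsDensity.integral_deriv_le (hρ : IsDensity ρ a m p L) {u : ℝ → ℝ} {C : ℝ}
    (hu : MemLp u 2 halfLine) (hC : ∀ x ∈ Ico (-a) 0, u x ^ 2 ≤ C) :
    ∫ x, deriv ρ x * (u x * u x) ∂halfLine ≤ a * (L * p * C) := by
  have hLp : 0 ≤ L * p := mul_nonneg hρ.L_nonneg hρ.p_pos.le
  have hb : ∀ x < 0, deriv ρ x * (u x * u x) ≤ (Ico (-a) 0).indicator (fun _ => L * p * C) x := by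
    intro x hx
    by_cases h : x < -a
    · rw [hρ.deriv_eq_zero h, zero_mul, indicator_of_notMem]
      grind
    · have hmem : x ∈ Ico (-a) 0 := by grind
      rw [indicator_of_mem hmem, ← sq]
      exact mul_le_mul (hρ.deriv_le_const hx) (hC x hmem) (sq_nonneg _) hLp
  have hm : halfLine (Ico (-a) 0) = ENNReal.ofReal a := by
    rw [Measure.restrict_apply measurableSet_Ico, inter_eq_left.2 Ico_subset_Iio_self, volume_Ico]
    simp
  calc _ ≤ ∫ x, (Ico (-a) 0).indicator (fun _ => L * p * C) x ∂halfLine := by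
        refine integral_mono_ae (hρ.integrable_deriv_mul hu hu) ?_ ?_
        · refine IntegrableOn.integrable_indicator ?_ measurableSet_Ico
          refine integrableOn_const ?_
          rw [hm]
          exact ENNReal.ofReal_ne_top
        · filter_upwards [ae_restrict_mem measurableSet_Iio] with x hx using hb x hx
    _ = _ := by
        rw [integral_indicator_const _ measurableSet_Ico, Measure.real, hm,
          ENNReal.toReal_ofReal hρ.a_pos.le, smul_eq_mul]

lemma inner_mulOperator {w : ℝ → ℝ} {M : HalfL2 →L[ℝ] HalfL2}
    (hM : ∀ f, M f =ᵐ[halfLine] fun x => w x * f x) {u v : HalfL2} {u' v' : ℝ → ℝ}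
    (hu : u =ᵐ[halfLine] u') (hv : v =ᵐ[halfLine] v') :
    ⟪M u, v⟫_ℝ = ∫ x, w x * (u' x * v' x) ∂halfLine := by
  rw [inner_halfL2]
  refine integral_congr_ae ?_
  filter_upwards [hM u, hu, hv] with x h1 h2 h3
  rw [h1, h2, h3, mul_assoc]

lemma IsDensity.inner_formOp_self (hρ : IsDensity ρ a m p L) {M : HalfL2 →L[ℝ] HalfL2}
    (hM : ∀ f, M f =ᵐ[halfLine] fun x => ρ x * f x) (s : ℝ) (f : HalfL2) :
    ⟪formOp μ g k M s f, f⟫_ℝ =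
      s ^ 2 * (k ^ 2 * ∫ x, ρ x * (prof f x * prof f x) ∂halfLine)
      + s ^ 2 * ∫ x, ρ x * (prof₁ f x * prof₁ f x) ∂halfLine
      + s * μ * (‖profileBend k f‖ ^ 2 + 4 * k ^ 2 * ‖profile₁ f‖ ^ 2)
      + g * k ^ 2 * (p * prof f 0 ^ 2 - ∫ x, deriv ρ x * (prof f x * prof f x) ∂halfLine) := by
  have h0 := coeFn_profile f
  have h1 := coeFn_profile₁ f
  rw [inner_formOp, inner_mulOperator hM h0 h0, inner_mulOperator hM h1 h1,
    inner_mulOperator hM h0 h1, inner_mulOperator hM h1 h0, real_inner_self_eq_norm_sq,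
    real_inner_self_eq_norm_sq, ← hρ.integral_boundary (Lp.memLp f)]
  simp_rw [mul_comm (prof₁ f _) (prof f _)]
  ring

lemma norm_sq_eq_integral {u : HalfL2} {u' : ℝ → ℝ} (hu : u =ᵐ[halfLine] u') :
    ‖u‖ ^ 2 = ∫ x, u' x * u' x ∂halfLine := by
  rw [← real_inner_self_eq_norm_sq, inner_halfL2]
  refine integral_congr_ae ?_
  filter_upwards [hu] with x h
  rw [h]

lemma IsDensity.mul_norm_sq_le (hρ : IsDensity ρ a m p L) {u : HalfL2} {u' : ℝ → ℝ}
    (hu : u =ᵐ[halfLine] u') : m * ‖u‖ ^ 2 ≤ ∫ x, ρ x * (u' x * u' x) ∂halfLine := by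
  have hm : MemLp u' 2 halfLine := (memLp_congr_ae hu).1 (Lp.memLp u)
  rw [norm_sq_eq_integral hu, ← integral_const_mul]
  refine integral_mono_ae ((hm.integrable_mul hm).const_mul m) (hρ.integrable_mul hm hm) ?_
  filter_upwards [ae_restrict_mem measurableSet_Iio] with x hx
  exact mul_le_mul_of_nonneg_right (hρ.lower x hx) (mul_self_nonneg _)

lemma norm_sq_le_profiles (k : ℝ) (f : HalfL2) : ‖f‖ ^ 2 ≤
    3 * (‖profileBend k f‖ ^ 2 + 4 * ‖profile₁ f‖ ^ 2 + (1 - k ^ 2) ^ 2 * ‖profile f‖ ^ 2) := by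
  have h : f = profileBend k f + (2 : ℝ) • profile₁ f + (1 - k ^ 2) • profile f := by
    simp only [profileBend, profile₁, profile, _root_.add_apply, _root_.sub_apply,
      _root_.smul_apply, ContinuousLinearMap.comp_apply, ContinuousLinearMap.id_apply]
    module
  have h1 : ‖f‖ ≤ ‖profileBend k f‖ + 2 * ‖profile₁ f‖ + |1 - k ^ 2| * ‖profile f‖ := by
    conv_lhs => rw [h]
    refine (norm_add₃_le).trans ?_
    rw [norm_smul, norm_smul]
    simp
  have h2 : ‖f‖ ^ 2 ≤ (‖profileBend k f‖ + 2 * ‖profile₁ f‖ + |1 - k ^ 2| * ‖profile f‖) ^ 2 := by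
    gcongr
  have h3 : (|1 - k ^ 2| * ‖profile f‖) ^ 2 = (1 - k ^ 2) ^ 2 * ‖profile f‖ ^ 2 := by
    rw [mul_pow, sq_abs]
  nlinarith [sq_nonneg (‖profileBend k f‖ - 2 * ‖profile₁ f‖),
    sq_nonneg (‖profileBend k f‖ - |1 - k ^ 2| * ‖profile f‖),
    sq_nonneg (2 * ‖profile₁ f‖ - |1 - k ^ 2| * ‖profile f‖)]

lemma IsDensity.coerciveModRank_formOp (hρ : IsDensity ρ a m p L) {M : HalfL2 →L[ℝ] HalfL2}
    (hM : ∀ f, M f =ᵐ[halfLine] fun x => ρ x * f x) (hμ : 0 < μ) (hg : 0 < g) (hk : 0 < k)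
    {s : ℝ} (hs : 0 < s) : ∃ n, CoerciveModRank (formOp μ g k M s) n := by
  have hm := hρ.m_pos
  have hp := hρ.p_pos
  have hL := hρ.L_nonneg
  have ha := hρ.a_pos
  obtain ⟨c, hc, hc1, hc2, hc3⟩ : ∃ c > 0, 3 * c ≤ s * μ ∧ 12 * c ≤ s * μ * (4 * k ^ 2) ∧
      3 * c * (1 - k ^ 2) ^ 2 ≤ s ^ 2 * (k ^ 2 * m) := by
    have hA : 0 < s * μ := by positivity
    have hB : 0 < s * μ * (4 * k ^ 2) := by positivity
    have hC : 0 < s ^ 2 * (k ^ 2 * m) := by positivity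
    refine ⟨min (s * μ / 3) (min (s * μ * (4 * k ^ 2) / 12)
      (s ^ 2 * (k ^ 2 * m) / (3 * (1 - k ^ 2) ^ 2 + 1))), by positivity, ?_, ?_, ?_⟩
    · have := min_le_left (s * μ / 3) (min (s * μ * (4 * k ^ 2) / 12)
        (s ^ 2 * (k ^ 2 * m) / (3 * (1 - k ^ 2) ^ 2 + 1)))
      linarith
    · have := (min_le_right (s * μ / 3) (min (s * μ * (4 * k ^ 2) / 12)
        (s ^ 2 * (k ^ 2 * m) / (3 * (1 - k ^ 2) ^ 2 + 1)))).trans (min_le_left _ _)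
      linarith
    · set c := min (s * μ / 3) (min (s * μ * (4 * k ^ 2) / 12)
        (s ^ 2 * (k ^ 2 * m) / (3 * (1 - k ^ 2) ^ 2 + 1))) with hcdef
      have hcpos : 0 < c := by positivity
      have := (min_le_right (s * μ / 3) (min (s * μ * (4 * k ^ 2) / 12)
        (s ^ 2 * (k ^ 2 * m) / (3 * (1 - k ^ 2) ^ 2 + 1)))).trans (min_le_right _ _)
      rw [le_div_iff₀ (by positivity)] at this
      linarith
  set K := g * k ^ 2 * (a * (L * p)) with hK
  have hK0 : 0 ≤ K := by positivity
  obtain ⟨n, ℓ, hℓ⟩ := exists_sq_prof_le ha (ε := c / (2 * (K + 1))) (by positivity)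
  refine ⟨n, sqrt (2 * K) • ℓ, c / 2, by positivity, fun f => ?_⟩
  have h1 := hρ.integral_deriv_le (memLp_prof (Lp.memLp f)) (hℓ f)
  have h2 := hρ.mul_norm_sq_le (coeFn_profile f)
  have h3 := hρ.mul_norm_sq_le (coeFn_profile₁ f)
  have h4 := norm_sq_le_profiles k f
  rw [hρ.inner_formOp_self hM, _root_.smul_apply, norm_smul, mul_pow, norm_eq_abs, sq_abs,
    sq_sqrt (by positivity)]
  have e1 : g * k ^ 2 * ∫ x, deriv ρ x * (prof f x * prof f x) ∂halfLine
      ≤ c / 2 * ‖f‖ ^ 2 + 2 * K * ‖ℓ f‖ ^ 2 := by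
    have hk1 : K * (c / (2 * (K + 1))) ≤ c / 2 := by
      rw [mul_div_assoc', div_le_div_iff₀ (by positivity) (by positivity)]
      nlinarith
    calc _ ≤ g * k ^ 2 * (a * (L * p * (c / (2 * (K + 1)) * ‖f‖ ^ 2 + 2 * ‖ℓ f‖ ^ 2))) := by gcongr
      _ = K * (c / (2 * (K + 1))) * ‖f‖ ^ 2 + 2 * K * ‖ℓ f‖ ^ 2 := by rw [hK]; ring
      _ ≤ _ := by gcongr
  have e2 : c * ‖f‖ ^ 2 ≤ s ^ 2 * (k ^ 2 * ∫ x, ρ x * (prof f x * prof f x) ∂halfLine)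
      + s * μ * (‖profileBend k f‖ ^ 2 + 4 * k ^ 2 * ‖profile₁ f‖ ^ 2) := by
    have h5 : s ^ 2 * (k ^ 2 * (m * ‖profile f‖ ^ 2))
        ≤ s ^ 2 * (k ^ 2 * ∫ x, ρ x * (prof f x * prof f x) ∂halfLine) := by gcongr
    have h6 := mul_le_mul_of_nonneg_right hc1 (sq_nonneg ‖profileBend k f‖)
    have h7 := mul_le_mul_of_nonneg_right hc2 (sq_nonneg ‖profile₁ f‖)
    have h8 := mul_le_mul_of_nonneg_right hc3 (sq_nonneg ‖profile f‖)
    have h9 := mul_le_mul_of_nonneg_left h4 hc.le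
    linarith
  have e3 : 0 ≤ s ^ 2 * ∫ x, ρ x * (prof₁ f x * prof₁ f x) ∂halfLine :=
    mul_nonneg (by positivity) (le_trans (by positivity) h3)
  have e4 : 0 ≤ g * k ^ 2 * (p * prof f 0 ^ 2) := by positivity
  linarith

end Coercivity

section NegativeDirections

open scoped ENNReal Topology InnerProductSpace ContDiff

lemma lagInt_deriv_add {u : ℝ → ℝ} (hu : ContDiff ℝ 1 u) (hc : HasCompactSupport u) {x : ℝ}
    (hx : x ≤ 0) : lagInt (fun y => deriv u y + u y) x = u x := by
  have hd : ∀ y, HasDerivAt (fun y => exp y * u y) (exp y * (deriv u y + u y)) y := fun y => by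
    refine ((Real.hasDerivAt_exp y).mul
      (hu.differentiable one_ne_zero y).hasDerivAt).congr_deriv ?_
    ring
  have h := HasCompactSupport.integral_Iic_deriv_eq (f := fun y => exp y * u y)
    (contDiff_exp.mul hu) hc.mul_left x
  rw [lagInt, halfLine_restrict_Iic hx]
  simp_rw [← fun y => (hd y).deriv]
  rw [h, ← mul_assoc, ← exp_add]
  simp

lemma exists_prof_eq {u : ℝ → ℝ} (hu : ContDiff ℝ ∞ u) (hc : HasCompactSupport u) :
    ∃ f : HalfL2, ∀ x ≤ 0, prof f x = u x := by
  have hu1 : ContDiff ℝ ∞ (deriv u) := contDiff_infty_iff_deriv.1 hu |>.2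
  have hu2 : ContDiff ℝ ∞ (deriv (deriv u)) := contDiff_infty_iff_deriv.1 hu1 |>.2
  set v : ℝ → ℝ := fun y => deriv u y + u y with hv
  have hvs : ContDiff ℝ ∞ v := hu1.add hu
  have hvc : HasCompactSupport v := hc.deriv.add hc
  set w : ℝ → ℝ := fun y => deriv v y + v y with hw
  have hws : Continuous w := (contDiff_infty_iff_deriv.1 hvs).2.continuous.add hvs.continuous
  have hwc : HasCompactSupport w := hvc.deriv.add hvc
  have hmem : MemLp w 2 halfLine := (hws.memLp_of_hasCompactSupport (μ := volume) hwc).restrict _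
  refine ⟨hmem.toLp, fun x hx => ?_⟩
  rw [prof, lagInt_congr hmem.coeFn_toLp, ← lagInt_deriv_add (hu.of_le (by simp)) hc hx]
  refine congrFun (lagInt_congr ?_) x
  filter_upwards [ae_restrict_mem measurableSet_Iio] with y hy
  exact lagInt_deriv_add (hvs.of_le (by simp)) hvc (le_of_lt hy)

variable {ρ : ℝ → ℝ} {a m p L μ g k : ℝ}

lemma IsDensity.exists_ball (hρ : IsDensity ρ a m p L) :
    ∃ x r : ℝ, 0 < r ∧ ∀ y ∈ Metric.ball x r, y < 0 ∧ 0 < deriv ρ y := by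
  obtain ⟨x, hx, hx0⟩ : ∃ x < 0, deriv ρ x ≠ 0 := by
    by_contra! h
    have hs : tsupport (deriv ρ) ⊆ Ici 0 := by
      refine closure_minimal (fun y hy => ?_) isClosed_Ici
      by_contra h'
      exact hy (h y (not_le.1 h'))
    rw [hρ.support] at hs
    have ha := hρ.a_pos
    have := hs (left_mem_Icc.2 (by linarith : -a ≤ 0))
    rw [mem_Ici] at this
    linarith
  have hpos : 0 < deriv ρ x := lt_of_le_of_ne (hρ.deriv_nonneg x hx) hx0.symm
  obtain ⟨r, hr, h⟩ := Metric.mem_nhds_iff.1 (Filter.inter_mem (Iio_mem_nhds hx)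
    (hρ.continuous_deriv.continuousAt.eventually (lt_mem_nhds hpos)))
  exact ⟨x, r, hr, fun y hy => h hy⟩

lemma IsDensity.negDim_formOp_zero (hρ : IsDensity ρ a m p L) {M : HalfL2 →L[ℝ] HalfL2}
    (hM : ∀ f, M f =ᵐ[halfLine] fun x => ρ x * f x) (hg : 0 < g) (hk : 0 < k) (N : ℕ) :
    NegDim (formOp μ g k M 0) N := by
  obtain ⟨x₀, r, hr, hball⟩ := hρ.exists_ball
  let χ : ContDiffBump x₀ := ⟨r / 2, r, by positivity, by linarith⟩
  choose e he using fun i : Fin N => exists_prof_eq (u := fun x => χ x * x ^ (i : ℕ))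
    (χ.contDiff.mul (contDiff_id.pow _)) χ.hasCompactSupport.mul_right
  let S : (Fin N → ℝ) →ₗ[ℝ] HalfL2 := Fintype.linearCombination ℝ e
  refine ⟨S, fun c hc => ?_⟩
  set P : Polynomial ℝ := ∑ i : Fin N, Polynomial.monomial i (c i) with hP
  have hP0 : P ≠ 0 := by
    obtain ⟨i, hi⟩ := Function.ne_iff.1 hc
    intro h
    apply hi
    have : P.coeff i = c i := by
      simp [hP, Polynomial.finsetSum_coeff, Polynomial.coeff_monomial, Fin.val_inj]
    rw [← this, h]
    simp
  have hprof : ∀ x ≤ 0, prof (S c) x = χ x * P.eval x := fun x hx => by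
    have h1 : ∀ f : HalfL2, prof f x = (lagEval x ∘L lag) f := fun f => by
      rw [ContinuousLinearMap.comp_apply, lagEval_apply, lagInt_congr (coeFn_lag f), prof]
    rw [h1, Fintype.linearCombination_apply, map_sum, Polynomial.eval_finsetSum, Finset.mul_sum]
    refine Finset.sum_congr rfl fun i _ => ?_
    rw [map_smul, ← h1, he i x hx, Polynomial.eval_monomial, smul_eq_mul]
    ring
  have h0 : prof (S c) 0 = 0 := by
    rw [hprof 0 le_rfl]
    have : (0 : ℝ) ∉ Function.support χ := by
      rw [χ.support_eq]
      exact fun h => lt_irrefl _ (hball 0 h).1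
    rw [Function.notMem_support.1 this, zero_mul]
  obtain ⟨x₁, hx₁, hx₁'⟩ : ∃ x ∈ Metric.ball x₀ r, P.eval x ≠ 0 := by
    by_contra! h
    refine hP0 (P.eq_zero_of_infinite_isRoot (Infinite.mono (s := Metric.ball x₀ r) h ?_))
    rw [Real.ball_eq_Ioo]
    exact Ioo_infinite (by linarith)
  have hφ := memLp_prof (Lp.memLp (S c))
  have hcont := continuous_prof (Lp.memLp (S c))
  have hpos : 0 < ∫ x, deriv ρ x * (prof (S c) x * prof (S c) x) ∂halfLine := by
    rw [setIntegral_pos_iff_support_of_nonneg_ae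
      (ae_restrict_of_forall_mem measurableSet_Iio fun x hx =>
        mul_nonneg (hρ.deriv_nonneg x hx) (mul_self_nonneg _)) (hρ.integrable_deriv_mul hφ hφ)]
    refine IsOpen.measure_pos _ (IsOpen.inter ?_ isOpen_Iio) ⟨x₁, ?_, (hball _ hx₁).1⟩
    · exact (hρ.continuous_deriv.mul (hcont.mul hcont)).isOpen_support
    · rw [Function.mem_support, hprof x₁ (hball _ hx₁).1.le]
      have h1 := (hball _ hx₁).2.ne'
      have h2 := (χ.pos_of_mem_ball hx₁).ne'
      positivity
  change inner ℝ (formOp μ g k M 0 (S c)) (S c) < 0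
  rw [hρ.inner_formOp_self hM, h0]
  have : 0 < g * k ^ 2 * ∫ x, deriv ρ x * (prof (S c) x * prof (S c) x) ∂halfLine := by positivity
  linarith

end NegativeDirections

section LinearSystems

open scoped ENNReal Topology ContDiff

variable {E : Type*} [NormedAddCommGroup E] [NormedSpace ℝ E]

lemma exists_linearODE_extension [CompleteSpace E] {A : ℝ → E →L[ℝ] E} (hA : Continuous A)
    (hA0 : ∀ x, 0 ≤ x → A x = A 0) {Y : ℝ → E} (hY : Continuous Y)
    (hd : ∀ x < 0, HasDerivAt Y (A x (Y x)) x) :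
    ∃ Z : ℝ → E, (∀ x ≤ 0, Z x = Y x) ∧ ∀ x, HasDerivAt Z (A x (Z x)) x := by
  set W : ℝ → E := fun x => NormedSpace.exp (x • A 0) (Y 0) with hW
  have hWd : ∀ x, HasDerivAt W (A 0 (W x)) x := fun x => by
    have h := hasDerivAt_exp_smul_const' (𝕂 := ℝ) (A 0) x
    exact h.clm_apply (hasDerivAt_const x (Y 0)) |>.congr_deriv (by simp [hW])
  set Z : ℝ → E := fun x => if x ≤ 0 then Y x else W x with hZ
  have hZc : Continuous Z := by
    refine hY.if_le (continuous_iff_continuousAt.2 fun x => (hWd x).continuousAt)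
      continuous_id continuous_const fun x hx => ?_
    have : x = 0 := hx
    simp [this, hW, NormedSpace.exp_zero]
  have hne : ∀ x, x ≠ 0 → HasDerivAt Z (A x (Z x)) x := by
    intro x hx
    rcases hx.lt_or_gt with h | h
    · have hZx : Z x = Y x := if_pos h.le
      rw [hZx]
      refine (hd x h).congr_of_eventuallyEq ?_
      filter_upwards [Iio_mem_nhds h] with y hy
      exact if_pos (le_of_lt hy)
    · have hZx : Z x = W x := if_neg (not_le.2 h)
      rw [hZx, hA0 x h.le]
      refine (hWd x).congr_of_eventuallyEq ?_
      filter_upwards [Ioi_mem_nhds h] with y hy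
      exact if_neg (not_le.2 hy)
  refine ⟨Z, fun x hx => if_pos hx, fun x => ?_⟩
  rcases eq_or_ne x 0 with rfl | hx
  · exact hasDerivAt_of_hasDerivAt_of_ne (g := fun x => A x (Z x)) hne hZc.continuousAt
      (hA.clm_apply hZc).continuousAt
  · exact hne x hx

lemma contDiff_of_linearODE {A : ℝ → E →L[ℝ] E} (hA : ContDiff ℝ ∞ A) {Z : ℝ → E}
    (hd : ∀ x, HasDerivAt Z (A x (Z x)) x) : ContDiff ℝ ∞ Z := by
  have hderiv : deriv Z = fun x => A x (Z x) := funext fun x => (hd x).deriv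
  refine contDiff_infty.2 fun n => ?_
  induction n with
  | zero =>
    exact contDiff_zero.2 (continuous_iff_continuousAt.2 fun x => (hd x).continuousAt)
  | succ n ih =>
    push_cast
    refine contDiff_succ_iff_deriv.2 ⟨fun x => (hd x).differentiableAt, by simp, ?_⟩
    rw [hderiv]
    exact (hA.of_le (by exact_mod_cast le_top)).clm_apply ih

lemma exists_iteratedDeriv_eq {A : ℝ → E →L[ℝ] E} (hA : ContDiff ℝ ∞ A) {Z : ℝ → E}
    (hd : ∀ x, HasDerivAt Z (A x (Z x)) x) {c : ℝ} {A₁ : E →L[ℝ] E} (hA₁ : ∀ x < c, A x = A₁)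
    (ℓ : E →L[ℝ] ℝ) (n : ℕ) :
    ∃ b : ℝ → E →L[ℝ] ℝ, ContDiff ℝ ∞ b ∧ (∃ b₁, ∀ x < c, b x = b₁) ∧
      iteratedDeriv n (fun x => ℓ (Z x)) = fun x => b x (Z x) := by
  induction n with
  | zero => exact ⟨fun _ => ℓ, contDiff_const, ⟨ℓ, fun _ _ => rfl⟩, iteratedDeriv_zero⟩
  | succ n ih =>
    obtain ⟨b, hb, ⟨b₁, hb₁⟩, h⟩ := ih
    refine ⟨fun x => deriv b x + (b x).comp (A x),
      (contDiff_infty_iff_deriv.1 hb).2.add (hb.clm_comp hA), ⟨b₁.comp A₁, fun x hx => ?_⟩, ?_⟩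
    · have : deriv b x = 0 := by
        have he : b =ᶠ[𝓝 x] fun _ => b₁ := by
          filter_upwards [Iio_mem_nhds hx] with y hy using hb₁ y hy
        rw [he.deriv_eq, deriv_const]
      simp only [this, zero_add, hb₁ x hx, hA₁ x hx]
    · rw [iteratedDeriv_succ, h]
      ext x
      have := ((hb.differentiable (by simp) x).hasDerivAt.clm_apply (hd x)).deriv
      rw [this]
      rfl

lemma exists_norm_le_of_eventually_const {F : Type*} [NormedAddCommGroup F] {b : ℝ → F}
    (hb : Continuous b) {c : ℝ} {b₁ : F} (hb₁ : ∀ x < c, b x = b₁) :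
    ∃ C, ∀ x < 0, ‖b x‖ ≤ C := by
  obtain ⟨C, hC⟩ := (isCompact_Icc (a := c) (b := 0)).exists_bound_of_continuousOn hb.continuousOn
  refine ⟨max C ‖b₁‖, fun x hx => ?_⟩
  rcases lt_or_ge x c with h | h
  · rw [hb₁ x h]
    exact le_max_right _ _
  · exact (hC x ⟨h, hx.le⟩).trans (le_max_left _ _)

end LinearSystems

section KernelSystem

open scoped ENNReal Topology InnerProductSpace ContDiff

variable {ρ : ℝ → ℝ} {a m p L μ g k s : ℝ}

/-- The coefficient matrix of the eigenvalue equation, as a first order system for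
`(φ, φ', s μ (φ'' + k² φ), N)`, when the density takes the value `r`. -/
def systemOp (μ g k s r : ℝ) : (Fin 4 → ℝ) →L[ℝ] (Fin 4 → ℝ) :=
  let pr : Fin 4 → (Fin 4 → ℝ) →L[ℝ] ℝ := fun i => ContinuousLinearMap.proj i
  ContinuousLinearMap.pi ![pr 1, (s * μ)⁻¹ • pr 2 - k ^ 2 • pr 0,
      (4 * k ^ 2 * (s * μ)) • pr 1 - pr 2 - pr 3,
      pr 3 + (1 + k ^ 2) • pr 2 - (4 * k ^ 2 * (s * μ)) • pr 1]
    + r • ContinuousLinearMap.pi ![0, 0, s ^ 2 • pr 1 + (g * k ^ 2) • pr 0,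
      (s ^ 2 * k ^ 2) • pr 0 + (g * k ^ 2) • pr 1 - s ^ 2 • pr 1 - (g * k ^ 2) • pr 0]

lemma systemOp_apply (μ g k s r : ℝ) (y : Fin 4 → ℝ) : systemOp μ g k s r y =
    ![y 1, (s * μ)⁻¹ * y 2 - k ^ 2 * y 0,
      4 * k ^ 2 * (s * μ) * y 1 - y 2 - y 3 + r * (s ^ 2 * y 1 + g * k ^ 2 * y 0),
      y 3 + (1 + k ^ 2) * y 2 - 4 * k ^ 2 * (s * μ) * y 1
        + r * (s ^ 2 * k ^ 2 * y 0 + g * k ^ 2 * y 1 - s ^ 2 * y 1 - g * k ^ 2 * y 0)] := by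
  ext i
  fin_cases i <;> simp [systemOp]

lemma contDiff_systemOp (hρ : ContDiff ℝ ∞ ρ) : ContDiff ℝ ∞ fun x => systemOp μ g k s (ρ x) := by
  unfold systemOp
  exact contDiff_const.add (ContDiff.smul hρ contDiff_const)

lemma memLp_leadInt (h : HalfL2) : MemLp (leadInt h) 2 halfLine :=
  (memLp_congr_ae (coeFn_adjoint_lag h)).1 (Lp.memLp _)

lemma formOp_apply (M : HalfL2 →L[ℝ] HalfL2) (f : HalfL2) :
    formOp μ g k M s f =
      let W := lag.adjoint
      let P := (s ^ 2 * k ^ 2) • M (profile f) + (g * k ^ 2) • M (profile₁ f)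
      let Q := s ^ 2 • M (profile₁ f) + (4 * k ^ 2 * (s * μ)) • profile₁ f
        + (g * k ^ 2) • M (profile f)
      let R := (s * μ) • profileBend k f
      W (W P) + (W Q - W (W Q)) + (R - (2 : ℝ) • W R + (1 + k ^ 2) • W (W R)) := by
  have hid : (ContinuousLinearMap.id ℝ HalfL2).adjoint = ContinuousLinearMap.id ℝ HalfL2 :=
    ContinuousLinearMap.adjoint_id
  have h0 : ∀ u, profile.adjoint u = lag.adjoint (lag.adjoint u) := fun u => by
    rw [profile, ContinuousLinearMap.adjoint_comp, ContinuousLinearMap.comp_apply]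
  have h1 : ∀ u, profile₁.adjoint u = lag.adjoint u - lag.adjoint (lag.adjoint u) := fun u => by
    rw [profile₁, map_sub, ContinuousLinearMap.adjoint_comp, _root_.sub_apply,
      ContinuousLinearMap.comp_apply]
  have h2 : ∀ u, (profileBend k).adjoint u = u - (2 : ℝ) • lag.adjoint u
      + (1 + k ^ 2) • lag.adjoint (lag.adjoint u) := fun u => by
    refine ext_inner_right ℝ fun v => ?_
    rw [ContinuousLinearMap.adjoint_inner_left]
    simp only [profileBend, _root_.add_apply, _root_.sub_apply, _root_.smul_apply,
      ContinuousLinearMap.comp_apply, ContinuousLinearMap.id_apply, inner_add_left, inner_add_right,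
      inner_sub_left, inner_sub_right, real_inner_smul_left, real_inner_smul_right,
      ContinuousLinearMap.adjoint_inner_left]
  simp only [formOp, _root_.add_apply, _root_.smul_apply, ContinuousLinearMap.comp_apply, h0, h1,
    h2, map_add, map_smul]
  module

/-- The profile of an element of the kernel of `formOp` solves a first order linear system. -/
lemma exists_of_formOp_eq_zero (hρ : IsDensity ρ a m p L) {M : HalfL2 →L[ℝ] HalfL2}
    (hM : ∀ f, M f =ᵐ[halfLine] fun x => ρ x * f x) (hs : s * μ ≠ 0) {f : HalfL2}
    (hf : formOp μ g k M s f = 0) :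
    ∃ R N : ℝ → ℝ, Continuous R ∧ Continuous N ∧ MemLp R 2 halfLine ∧ MemLp N 2 halfLine ∧
      R 0 = 0 ∧ N 0 = 0 ∧ ∀ x < 0,
        HasDerivAt (prof f) (prof₁ f x) x ∧
        HasDerivAt (prof₁ f) ((s * μ)⁻¹ * R x - k ^ 2 * prof f x) x ∧
        HasDerivAt R (4 * k ^ 2 * (s * μ) * prof₁ f x - R x - N x
          + ρ x * (s ^ 2 * prof₁ f x + g * k ^ 2 * prof f x)) x ∧
        HasDerivAt N (N x + (1 + k ^ 2) * R x - 4 * k ^ 2 * (s * μ) * prof₁ f x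
          + ρ x * (s ^ 2 * k ^ 2 * prof f x + g * k ^ 2 * prof₁ f x - s ^ 2 * prof₁ f x
            - g * k ^ 2 * prof f x)) x := by
  rw [formOp_apply] at hf
  simp only at hf
  set P := (s ^ 2 * k ^ 2) • M (profile f) + (g * k ^ 2) • M (profile₁ f) with hP
  set Q := s ^ 2 • M (profile₁ f) + (4 * k ^ 2 * (s * μ)) • profile₁ f
    + (g * k ^ 2) • M (profile f) with hQ
  set r := (s * μ) • profileBend k f with hr
  set z : HalfL2 := Q - P - (1 + k ^ 2) • r with hz
  set S : HalfL2 := (2 : ℝ) • r - Q + lag.adjoint z with hS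
  have hrS : r = lag.adjoint S := by
    rw [← sub_eq_zero, ← hf, hS, hz]
    simp only [map_add, map_sub, map_smul]
    module
  have h0 := coeFn_profile f
  have h1 := coeFn_profile₁ f
  have hfm := Lp.memLp f
  set R := leadInt S
  set N := leadInt z
  have hrR : r =ᵐ[halfLine] R := by
    rw [hrS]
    exact coeFn_adjoint_lag S
  have hRc : Continuous R := continuous_leadInt (Lp.memLp S)
  have hNc : Continuous N := continuous_leadInt (Lp.memLp z)
  have hφc := continuous_prof hfm
  have hφc1 := continuous_prof₁ hfm
  have hρc := hρ.smooth.continuous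
  have hQa : Q =ᵐ[halfLine] fun x => 4 * k ^ 2 * (s * μ) * prof₁ f x
      + ρ x * (s ^ 2 * prof₁ f x + g * k ^ 2 * prof f x) := by
    filter_upwards [h0, h1, hM (profile f), hM (profile₁ f),
      Lp.coeFn_add (s ^ 2 • M (profile₁ f) + (4 * k ^ 2 * (s * μ)) • profile₁ f)
        ((g * k ^ 2) • M (profile f)),
      Lp.coeFn_add (s ^ 2 • M (profile₁ f)) ((4 * k ^ 2 * (s * μ)) • profile₁ f),
      Lp.coeFn_smul (s ^ 2) (M (profile₁ f)), Lp.coeFn_smul (4 * k ^ 2 * (s * μ)) (profile₁ f),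
      Lp.coeFn_smul (g * k ^ 2) (M (profile f))] with x e0 e1 e2 e3 e4 e5 e6 e7 e8
    rw [hQ, e4, Pi.add_apply, e5, Pi.add_apply, e6, e7, e8]
    simp only [Pi.smul_apply, smul_eq_mul]
    rw [e2, e3, e0, e1]
    ring
  have hPa : P =ᵐ[halfLine] fun x => ρ x * (s ^ 2 * k ^ 2 * prof f x + g * k ^ 2 * prof₁ f x) := by
    filter_upwards [h0, h1, hM (profile f), hM (profile₁ f),
      Lp.coeFn_add ((s ^ 2 * k ^ 2) • M (profile f)) ((g * k ^ 2) • M (profile₁ f)),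
      Lp.coeFn_smul (s ^ 2 * k ^ 2) (M (profile f)),
      Lp.coeFn_smul (g * k ^ 2) (M (profile₁ f))] with x e0 e1 e2 e3 e4 e5 e6
    rw [hP, e4, Pi.add_apply, e5, e6]
    simp only [Pi.smul_apply, smul_eq_mul]
    rw [e2, e3, e0, e1]
    ring
  set Zf : ℝ → ℝ := fun x => 4 * k ^ 2 * (s * μ) * prof₁ f x
      + ρ x * (s ^ 2 * prof₁ f x + g * k ^ 2 * prof f x)
      - ρ x * (s ^ 2 * k ^ 2 * prof f x + g * k ^ 2 * prof₁ f x) - (1 + k ^ 2) * R x with hZf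
  have hza : z =ᵐ[halfLine] Zf := by
    filter_upwards [hQa, hPa, hrR, Lp.coeFn_sub (Q - P) ((1 + k ^ 2) • r), Lp.coeFn_sub Q P,
      Lp.coeFn_smul (1 + k ^ 2) r] with x e0 e1 e2 e3 e4 e5
    rw [hz, e3, Pi.sub_apply, e4, Pi.sub_apply, e5, Pi.smul_apply, e0, e1, e2, smul_eq_mul]
  set Sf : ℝ → ℝ := fun x => 2 * R x - (4 * k ^ 2 * (s * μ) * prof₁ f x
      + ρ x * (s ^ 2 * prof₁ f x + g * k ^ 2 * prof f x)) + N x with hSf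
  have hSa : S =ᵐ[halfLine] Sf := by
    filter_upwards [hQa, hrR, coeFn_adjoint_lag z, Lp.coeFn_add ((2 : ℝ) • r - Q) (lag.adjoint z),
      Lp.coeFn_sub ((2 : ℝ) • r) Q, Lp.coeFn_smul (2 : ℝ) r] with x e0 e1 e2 e3 e4 e5
    rw [hS, e3, Pi.add_apply, e4, Pi.sub_apply, e5, Pi.smul_apply, e0, e1, e2, smul_eq_mul]
  set F : ℝ → ℝ := fun x => (s * μ)⁻¹ * R x + 2 * lagInt f x - (1 + k ^ 2) * prof f x with hF
  have hFa : f =ᵐ[halfLine] F := by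
    filter_upwards [hrR, coeFn_profileBend k f, Lp.coeFn_smul (s * μ) (profileBend k f)]
      with x e0 e1 e2
    rw [hF]
    simp only
    rw [← e0, hr, e2, Pi.smul_apply, e1, smul_eq_mul, inv_mul_cancel_left₀ hs]
    ring
  have hFm : MemLp F 2 halfLine := (memLp_congr_ae hFa).1 hfm
  have hZm : MemLp Zf 2 halfLine := (memLp_congr_ae hza).1 (Lp.memLp z)
  have hSm : MemLp Sf 2 halfLine := (memLp_congr_ae hSa).1 (Lp.memLp S)
  have hgc := continuous_lagInt hfm
  have hFc : Continuous F := by fun_prop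
  have hZc : Continuous Zf := by fun_prop
  have hSc : Continuous Sf := by fun_prop
  refine ⟨R, N, hRc, hNc, memLp_leadInt S, memLp_leadInt z, leadInt_zero S, leadInt_zero z,
    fun x hx => ⟨hasDerivAt_prof hfm hx, ?_, ?_, ?_⟩⟩
  · have h2 := hasDerivAt_lagInt hFm hFc hx
    rw [← lagInt_congr hFa] at h2
    refine (h2.sub (hasDerivAt_prof hfm hx)).congr_deriv ?_
    simp only [hF, prof₁, Pi.sub_apply]
    ring
  · have h2 := hasDerivAt_leadInt hSm hSc hx
    rw [← leadInt_congr hSa] at h2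
    refine h2.congr_deriv ?_
    simp only [hSf]
    change R x - _ = _
    ring
  · have h2 := hasDerivAt_leadInt hZm hZc hx
    rw [← leadInt_congr hza] at h2
    refine h2.congr_deriv ?_
    simp only [hZf]
    change N x - _ = _
    ring

end KernelSystem

section Eigenfunctions

open scoped ENNReal Topology InnerProductSpace ContDiff

variable {ρ : ℝ → ℝ} {a m p L μ g k s : ℝ}

lemma IsDensity.eq_zero_of_formOp_eq_zero (hρ : IsDensity ρ a m p L) {M : HalfL2 →L[ℝ] HalfL2}
    (hM : ∀ f, M f =ᵐ[halfLine] fun x => ρ x * f x) (hμ : 0 < μ) (hg : 0 < g) (hk : 0 < k)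
    (hs : 0 < s) {f : HalfL2} (hf : formOp μ g k M s f = 0)
    (hle : g * ∫ x, deriv ρ x * (prof f x * prof f x) ∂halfLine
      ≤ s ^ 2 * ∫ x, ρ x * (prof f x * prof f x) ∂halfLine) : f = 0 := by
  have h := hρ.inner_formOp_self (μ := μ) (g := g) (k := k) hM s f
  rw [hf, inner_zero_left] at h
  have hm := hρ.m_pos
  have hp := hρ.p_pos
  have hA := hρ.mul_norm_sq_le (coeFn_profile₁ f)
  have h1 : 0 ≤ s ^ 2 * ∫ x, ρ x * (prof₁ f x * prof₁ f x) ∂halfLine :=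
    mul_nonneg (by positivity) (le_trans (by positivity) hA)
  have h2 : 0 ≤ g * k ^ 2 * (p * prof f 0 ^ 2) := by positivity
  have h3 := mul_le_mul_of_nonneg_left hle (sq_nonneg k)
  have h4 : s * μ * (‖profileBend k f‖ ^ 2 + 4 * k ^ 2 * ‖profile₁ f‖ ^ 2) ≤ 0 := by linarith
  have h5 : ‖profileBend k f‖ ^ 2 + 4 * k ^ 2 * ‖profile₁ f‖ ^ 2 ≤ 0 := by
    by_contra! hc
    have : 0 < s * μ * (‖profileBend k f‖ ^ 2 + 4 * k ^ 2 * ‖profile₁ f‖ ^ 2) := by positivity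
    linarith
  have hk2 : 0 < 4 * k ^ 2 := by positivity
  have hb : ‖profileBend k f‖ ^ 2 = 0 := by
    nlinarith [sq_nonneg ‖profileBend k f‖, mul_nonneg hk2.le (sq_nonneg ‖profile₁ f‖)]
  have h₁ : ‖profile₁ f‖ ^ 2 = 0 := by
    nlinarith [sq_nonneg ‖profileBend k f‖, mul_nonneg hk2.le (sq_nonneg ‖profile₁ f‖)]
  have hconst : ∀ x < 0, prof f x = 0 := by
    intro x hx
    have hev : ∀ᶠ y in atBot, prof f y = prof f x := by
      filter_upwards [eventually_le_atBot x] with y hy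
      have := sq_sub_le_mul_norm_sq f hy hx
      rw [h₁, mul_zero] at this
      have := pow_eq_zero_iff two_ne_zero |>.1 (le_antisymm this (sq_nonneg _))
      linarith
    exact tendsto_nhds_unique (tendsto_const_nhds.congr' (hev.mono fun _ h => h.symm))
      (tendsto_prof (Lp.memLp f))
  have h0 : ‖profile f‖ ^ 2 = 0 := by
    rw [norm_sq_eq_integral (coeFn_profile f)]
    refine integral_eq_zero_of_ae ?_
    filter_upwards [ae_restrict_mem measurableSet_Iio] with x hx
    simp [hconst x hx]
  have hn := norm_sq_le_profiles k f
  rw [hb, h₁, h0] at hn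
  rw [← norm_eq_zero, ← pow_eq_zero_iff two_ne_zero]
  exact le_antisymm (by linarith) (sq_nonneg _)

lemma IsDensity.sq_lt_of_formOp_eq_zero (hρ : IsDensity ρ a m p L) {M : HalfL2 →L[ℝ] HalfL2}
    (hM : ∀ f, M f =ᵐ[halfLine] fun x => ρ x * f x) (hμ : 0 < μ) (hg : 0 < g) (hk : 0 < k)
    (hs : 0 < s) {f : HalfL2} (hf0 : f ≠ 0) (hf : formOp μ g k M s f = 0) : s ^ 2 < g * L := by
  by_contra! hle
  refine hf0 (hρ.eq_zero_of_formOp_eq_zero hM hμ hg hk hs hf ?_)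
  have hφ := memLp_prof (Lp.memLp f)
  have h1 : ∫ x, deriv ρ x * (prof f x * prof f x) ∂halfLine
      ≤ L * ∫ x, ρ x * (prof f x * prof f x) ∂halfLine := by
    rw [← integral_const_mul]
    refine integral_mono_ae (hρ.integrable_deriv_mul hφ hφ)
      ((hρ.integrable_mul hφ hφ).const_mul L) ?_
    filter_upwards [ae_restrict_mem measurableSet_Iio] with x hx
    exact (mul_le_mul_of_nonneg_right (hρ.deriv_le x hx) (mul_self_nonneg _)).trans_eq
      (mul_assoc _ _ _)
  have h2 : 0 ≤ ∫ x, ρ x * (prof f x * prof f x) ∂halfLine :=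
    le_trans (mul_nonneg hρ.m_pos.le (sq_nonneg _)) (hρ.mul_norm_sq_le (coeFn_profile f))
  calc _ ≤ g * (L * ∫ x, ρ x * (prof f x * prof f x) ∂halfLine) := by gcongr
    _ = g * L * ∫ x, ρ x * (prof f x * prof f x) ∂halfLine := by ring
    _ ≤ _ := by gcongr

lemma exists_smooth_solution (hρ : IsDensity ρ a m p L) {M : HalfL2 →L[ℝ] HalfL2}
    (hM : ∀ f, M f =ᵐ[halfLine] fun x => ρ x * f x) (hs : s * μ ≠ 0) {f : HalfL2}
    (hf : formOp μ g k M s f = 0) :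
    ∃ Z : ℝ → Fin 4 → ℝ, (∀ x, HasDerivAt Z (systemOp μ g k s (ρ x) (Z x)) x) ∧
      MemLp Z 2 halfLine ∧ (∀ x ≤ 0, Z x 0 = prof f x) ∧ Z 0 2 = 0 ∧ Z 0 3 = 0 := by
  obtain ⟨R, N, hR, hN, hRm, hNm, hR0, hN0, hd⟩ := exists_of_formOp_eq_zero hρ hM hs hf
  have hfm := Lp.memLp f
  set Y : ℝ → Fin 4 → ℝ := fun x => ![prof f x, prof₁ f x, R x, N x] with hYdef
  have hY : Continuous Y := by
    refine continuous_pi fun i => ?_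
    fin_cases i
    exacts [continuous_prof hfm, continuous_prof₁ hfm, hR, hN]
  have hYm : MemLp Y 2 halfLine := by
    refine MemLp.of_eval fun i => ?_
    fin_cases i
    exacts [memLp_prof hfm, memLp_prof₁ hfm, hRm, hNm]
  have hYd : ∀ x < 0, HasDerivAt Y (systemOp μ g k s (ρ x) (Y x)) x := by
    intro x hx
    obtain ⟨h0, h1, h2, h3⟩ := hd x hx
    rw [systemOp_apply]
    refine hasDerivAt_pi.2 fun i => ?_
    fin_cases i
    exacts [h0, h1, h2, h3]
  obtain ⟨Z, hZ, hZd⟩ := exists_linearODE_extension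
    (contDiff_systemOp (μ := μ) (g := g) (k := k) (s := s) hρ.smooth).continuous
    (fun x hx => by rw [hρ.right x hx, hρ.right 0 le_rfl]) hY hYd
  refine ⟨Z, hZd, (memLp_congr_ae ?_).1 hYm, fun x hx => ?_, ?_, ?_⟩
  · filter_upwards [ae_restrict_mem measurableSet_Iio] with x hx using (hZ x (le_of_lt hx)).symm
  · rw [hZ x hx]
    rfl
  · rw [hZ 0 le_rfl]
    exact hR0
  · rw [hZ 0 le_rfl]
    exact hN0

lemma memHinf_of_system (hρ : IsDensity ρ a m p L) {Z : ℝ → Fin 4 → ℝ}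
    (hZ : ∀ x, HasDerivAt Z (systemOp μ g k s (ρ x) (Z x)) x) (hZm : MemLp Z 2 halfLine) :
    MemHinf fun x => Z x 0 := by
  have hA := contDiff_systemOp (μ := μ) (g := g) (k := k) (s := s) hρ.smooth
  have hZs := contDiff_of_linearODE hA hZ
  refine ⟨contDiff_pi.1 hZs 0, fun n => ?_⟩
  obtain ⟨b, hb, ⟨b₁, hb₁⟩, h⟩ := exists_iteratedDeriv_eq hA hZ (c := -a)
    (fun x hx => by rw [hρ.left x hx.le]) (ContinuousLinearMap.proj 0) n
  obtain ⟨C, hC⟩ := exists_norm_le_of_eventually_const hb.continuous hb₁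
  refine MemLp.integrable_sq ?_
  change MemLp (iteratedDeriv n fun x => ContinuousLinearMap.proj (R := ℝ) (φ := fun _ : Fin 4 => ℝ)
    0 (Z x)) 2 halfLine
  rw [h]
  refine hZm.of_le_mul (c := C) (hb.continuous.clm_apply hZs.continuous).aestronglyMeasurable ?_
  filter_upwards [ae_restrict_mem measurableSet_Iio] with x hx
  exact (b x).le_of_opNorm_le (hC x hx) _

lemma isEVPSolution_of_system (hρ : IsDensity ρ a m p L) (hs : s * μ ≠ 0) {Z : ℝ → Fin 4 → ℝ}
    (hZ : ∀ x, HasDerivAt Z (systemOp μ g k s (ρ x) (Z x)) x) (h2 : Z 0 2 = 0) (h3 : Z 0 3 = 0)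
    (hlim : Tendsto (fun x => Z x 0) atBot (𝓝 0)) :
    IsEVPSolution μ g k p ρ s fun x => Z x 0 := by
  have hs0 : s ≠ 0 := left_ne_zero_of_mul hs
  have hμ0 : μ ≠ 0 := right_ne_zero_of_mul hs
  have hd : ∀ x i, HasDerivAt (fun x => Z x i) (systemOp μ g k s (ρ x) (Z x) i) x := fun x i =>
    hasDerivAt_pi.1 (hZ x) i
  simp only [systemOp_apply] at hd
  have d0 : ∀ x, HasDerivAt (fun x => Z x 0) (Z x 1) x := fun x => hd x 0
  have d1 : ∀ x, HasDerivAt (fun x => Z x 1) ((s * μ)⁻¹ * Z x 2 - k ^ 2 * Z x 0) x := fun x =>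
    hd x 1
  have d2 : ∀ x, HasDerivAt (fun x => Z x 2) (4 * k ^ 2 * (s * μ) * Z x 1 - Z x 2 - Z x 3
      + ρ x * (s ^ 2 * Z x 1 + g * k ^ 2 * Z x 0)) x := fun x => hd x 2
  have d3 : ∀ x, HasDerivAt (fun x => Z x 3) (Z x 3 + (1 + k ^ 2) * Z x 2
      - 4 * k ^ 2 * (s * μ) * Z x 1 + ρ x * (s ^ 2 * k ^ 2 * Z x 0 + g * k ^ 2 * Z x 1
        - s ^ 2 * Z x 1 - g * k ^ 2 * Z x 0)) x := fun x => hd x 3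
  have i1 : deriv (fun x => Z x 0) = fun x => Z x 1 := funext fun x => (d0 x).deriv
  have i2 : iteratedDeriv 2 (fun x => Z x 0) = fun x => (s * μ)⁻¹ * Z x 2 - k ^ 2 * Z x 0 := by
    rw [iteratedDeriv_succ, iteratedDeriv_one, i1]
    exact funext fun x => (d1 x).deriv
  have i3 : iteratedDeriv 3 (fun x => Z x 0) = fun x => (s * μ)⁻¹ * (4 * k ^ 2 * (s * μ) * Z x 1
      - Z x 2 - Z x 3 + ρ x * (s ^ 2 * Z x 1 + g * k ^ 2 * Z x 0)) - k ^ 2 * Z x 1 := by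
    rw [iteratedDeriv_succ, i2]
    exact funext fun x => (((d2 x).const_mul _).sub ((d0 x).const_mul _)).deriv
  have i4 := iteratedDeriv_succ (n := 3) (f := fun x => Z x 0)
  rw [i3] at i4
  refine ⟨fun x _ => ?_, ?_, ?_, hlim⟩
  · have e4 : iteratedDeriv 4 (fun x => Z x 0) x = _ :=
      (congrFun i4 x).trans (((((((d1 x).const_mul (4 * k ^ 2 * (s * μ))).sub (d2 x)).sub
        (d3 x)).add ((hρ.hasDerivAt x).mul (((d1 x).const_mul (s ^ 2)).add
          ((d0 x).const_mul (g * k ^ 2))))).const_mul (s * μ)⁻¹).sub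
            ((d1 x).const_mul (k ^ 2))).deriv
    have e1 : deriv (fun y => ρ y * deriv (fun x => Z x 0) y) x
        = deriv ρ x * Z x 1 + ρ x * ((s * μ)⁻¹ * Z x 2 - k ^ 2 * Z x 0) := by
      rw [i1]
      exact ((hρ.hasDerivAt x).mul (d1 x)).deriv
    rw [e4, e1, i2]
    simp only [Pi.add_apply]
    field_simp
    ring
  · rw [i2]
    simp only [h2]
    ring
  · rw [i3, i1]
    simp only [h2, h3, hρ.right 0 le_rfl]
    field_simp
    ring

end Eigenfunctions

lemma infinite_setOf_eigenvalue {ρ : ℝ → ℝ} {a m p L μ g k : ℝ} (hρ : IsDensity ρ a m p L)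
    (hμ : 0 < μ) (hg : 0 < g) (hk : 0 < k) :
    {s | s ∈ Ioo 0 (Real.sqrt (g * L)) ∧ ∃ φ : ℝ → ℝ, MemHinf φ ∧ (∃ x ≤ (0 : ℝ), φ x ≠ 0) ∧
      IsEVPSolution μ g k p ρ s φ}.Infinite := by
  obtain ⟨M, hM⟩ := exists_mulOperator hρ.smooth.continuous fun x hx => hρ.abs_le hx
  refine (infinite_setOf_degenerate (continuous_formOp μ g k M)
    (formOp_isSymmetric μ g k (mulOperator_symmetric hM))
    (fun s hs => hρ.coerciveModRank_formOp hM hμ hg hk hs)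
    (hρ.negDim_formOp_zero hM hg hk)).mono ?_
  rintro s ⟨hs, f, hf0, hf⟩
  have hsμ : s * μ ≠ 0 := (mul_pos hs hμ).ne'
  obtain ⟨Z, hZ, hZm, hZf, h2, h3⟩ := exists_smooth_solution hρ hM hsμ hf
  refine ⟨⟨hs, Real.lt_sqrt_of_sq_lt (hρ.sq_lt_of_formOp_eq_zero hM hμ hg hk hs hf0 hf)⟩,
    fun x => Z x 0, memHinf_of_system hρ hZ hZm, ?_, isEVPSolution_of_system hρ hsμ hZ h2 h3 ?_⟩
  · by_contra! h
    refine hf0 (hρ.eq_zero_of_formOp_eq_zero hM hμ hg hk hs hf (le_of_eq ?_))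
    have hz : ∀ w : ℝ → ℝ, ∫ x, w x * (prof f x * prof f x) ∂halfLine = 0 := fun w => by
      refine integral_eq_zero_of_ae ?_
      filter_upwards [ae_restrict_mem measurableSet_Iio] with x hx
      simp [← hZf x (le_of_lt hx), h x (le_of_lt hx)]
    rw [hz, hz, mul_zero, mul_zero]
  · refine (tendsto_prof (Lp.memLp f)).congr' ?_
    filter_upwards [eventually_le_atBot 0] with x hx using (hZf x hx).symm

lemma isDensity_of_hypotheses {a ρm ρp L : ℝ} {ρ₀ : ℝ → ℝ} (ha : 0 < a) (hρm : 0 < ρm)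
    (hρ₀ : ContDiff ℝ (⊤ : ℕ∞) ρ₀) (hρ₀pos : ∀ x ≤ (0 : ℝ), 0 < ρ₀ x)
    (hρ₀mono : ∀ x ≤ (0 : ℝ), 0 ≤ deriv ρ₀ x) (hsupp : tsupport (deriv ρ₀) = Icc (-a) 0)
    (hflat : ∀ x ≤ -a, ρ₀ x = ρm) (hρp : ρ₀ 0 = ρp) (hL : 0 < L)
    (hLsup : L = sSup ((fun x => |deriv ρ₀ x| / ρ₀ x) '' Iio (0 : ℝ))) :
    IsDensity ρ₀ a ρm ρp L := by
  have hdiff : Differentiable ℝ ρ₀ := hρ₀.differentiable (by simp)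
  have hmono : MonotoneOn ρ₀ (Iic 0) := by
    refine monotoneOn_of_deriv_nonneg (convex_Iic 0) hρ₀.continuous.continuousOn
      hdiff.differentiableOn fun x hx => hρ₀mono x ?_
    rw [interior_Iic] at hx
    exact le_of_lt hx
  refine ⟨hρ₀, ha, hρm, fun x hx => ?_, fun x hx => ?_, fun x hx => hρ₀mono x hx.le,
    fun x hx => ?_, hflat, fun x hx => ?_, hsupp⟩
  · have h1 : min x (-a) ≤ x := min_le_left _ _
    rw [← hflat (min x (-a)) (min_le_right _ _)]
    exact hmono (mem_Iic.2 (h1.trans hx.le)) (mem_Iic.2 hx.le) h1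
  · rw [← hρp]
    exact hmono (mem_Iic.2 hx.le) (mem_Iic.2 le_rfl) hx.le
  · have hbdd : BddAbove ((fun x => |deriv ρ₀ x| / ρ₀ x) '' Iio (0 : ℝ)) := by
      by_contra h
      rw [Real.sSup_of_not_bddAbove h] at hLsup
      exact hL.ne' hLsup
    have h := le_csSup hbdd (mem_image_of_mem _ hx)
    rw [← hLsup, div_le_iff₀ (hρ₀pos x hx.le), abs_of_nonneg (hρ₀mono x hx.le)] at h
    exact h
  · have hanti : MonotoneOn ρ₀ (Ici 0) ∧ AntitoneOn ρ₀ (Ici 0) := by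
      have hz : ∀ y ∈ interior (Ici (0 : ℝ)), deriv ρ₀ y = 0 := fun y hy => by
        rw [interior_Ici] at hy
        refine image_eq_zero_of_notMem_tsupport (f := deriv ρ₀) ?_
        rw [hsupp]
        exact fun h => not_lt.2 h.2 hy
      exact ⟨monotoneOn_of_deriv_nonneg (convex_Ici 0) hρ₀.continuous.continuousOn
        hdiff.differentiableOn fun y hy => (hz y hy).ge,
        antitoneOn_of_deriv_nonpos (convex_Ici 0) hρ₀.continuous.continuousOn
        hdiff.differentiableOn fun y hy => (hz y hy).le⟩
    rw [← hρp]
    exact le_antisymm (hanti.2 (mem_Ici.2 le_rfl) hx hx) (hanti.1 (mem_Ici.2 le_rfl) hx hx)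

/-- There is an infinite sequence `(λₙ, φₙ)` of characteristic values and nontrivial
`H^∞(ℝ₋)` eigenfunctions of the EVP, with `λₙ ∈ (0, √(g/L₀))` and the `λₙ` pairwise
distinct (in particular there are infinitely many characteristic values). -/
theorem statement1
    (μ g a k ρm ρp L₀ : ℝ) (ρ₀ : ℝ → ℝ)
    (hμ : 0 < μ) (hg : 0 < g) (ha : 0 < a) (hk : 0 < k) (hρm : 0 < ρm)
    (hρ₀ : ContDiff ℝ (⊤ : ℕ∞) ρ₀) (hρ₀pos : ∀ x ≤ (0 : ℝ), 0 < ρ₀ x)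
    (hρ₀mono : ∀ x ≤ (0 : ℝ), 0 ≤ deriv ρ₀ x)
    (hsupp : tsupport (deriv ρ₀) = Icc (-a) 0)
    (hflat : ∀ x ≤ -a, ρ₀ x = ρm) (hρp : ρ₀ 0 = ρp)
    (hL₀pos : 0 < L₀)
    (hL₀ : L₀⁻¹ = sSup ((fun x => |deriv ρ₀ x| / ρ₀ x) '' Iio (0 : ℝ))) :
    ∃ (lam : ℕ → ℝ) (φ : ℕ → ℝ → ℝ),
      Function.Injective lam ∧
      ∀ n : ℕ,
        lam n ∈ Ioo 0 (Real.sqrt (g / L₀)) ∧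
        MemHinf (φ n) ∧
        (∃ x ≤ (0 : ℝ), φ n x ≠ 0) ∧
        IsEVPSolution μ g k ρp ρ₀ (lam n) (φ n) := by
  
  have hρ := isDensity_of_hypotheses ha hρm hρ₀ hρ₀pos hρ₀mono hsupp hflat hρp
    (inv_pos.2 hL₀pos) hL₀
  have hinf := infinite_setOf_eigenvalue hρ hμ hg hk
  rw [← div_eq_mul_inv] at hinf
  have hmem := fun n => (hinf.natEmbedding _ n).2
  choose hlam φ hφ using hmem
  exact ⟨fun n => hinf.natEmbedding _ n, φ,
    Subtype.val_injective.comp (hinf.natEmbedding _).injective, fun n => ⟨hlam n, hφ n⟩⟩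
end
end
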